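/- Let ψ : ℕ → (0,∞) be an approximating function and let 0 < s ≤ 1. If the series Σ_{h=1}^∞ h^{1−s} (log h)^s ψ(h)^s converges, then ℋ^s(C_f ∩ S₂*(ψ)) = 0. -/

import Mathlib

open MeasureTheory Filter

/-- Distance from `x` to the nearest integer, `‖x‖ = min_{z ∈ ℤ} |x - z|`. -/
noncomputable def nint (x : ℝ) : ℝ := ⨅ z : ℤ, |x - (z : ℝ)|

/-- `S₂*(ψ)`: points `(x, y) ∈ ℝ²` with `‖qx‖ ⬝ ‖qy‖ < ψ(q)` for infinitely many `q ∈ ℕ`. -/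
def S2star (ψ : ℕ → ℝ) : Set (EuclideanSpace ℝ (Fin 2)) :=
  { p | {q : ℕ | 0 < q ∧ nint (q * p 0) * nint (q * p 1) < ψ q}.Infinite }

section

/-- A finite set whose image under `h` is `δ`-separated and has diameter at most `X` has at most
`1 + X / δ` elements. -/
lemma card_le_of_separated {α : Type*} (S : Finset α) (h : α → ℝ) {δ X : ℝ} (hδ : 0 < δ)
    (hX : 0 ≤ X) (hdiam : ∀ x ∈ S, ∀ y ∈ S, h x - h y ≤ X)
    (hsep : ∀ x ∈ S, ∀ y ∈ S, x ≠ y → δ ≤ |h x - h y|) :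
    (S.card : ℝ) ≤ 1 + X / δ := by
  rcases S.eq_empty_or_nonempty with rfl | hne
  · simp; positivity
  obtain ⟨x₀, hx₀, hmin⟩ := S.exists_min_image h hne
  have hle : S.card ≤ (Finset.range (⌊X / δ⌋₊ + 1)).card := by
    refine Finset.card_le_card_of_injOn (fun x => ⌊(h x - h x₀) / δ⌋₊) ?_ ?_
    · intro x hx
      simp only [Finset.coe_range, Set.mem_Iio]
      refine Nat.lt_succ_of_le (Nat.floor_le_floor ?_)
      gcongr
      exact hdiam x hx x₀ hx₀
    · intro x hx y hy hxy
      by_contra hne'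
      have h1 := hsep x hx y hy hne'
      have hx1 : 0 ≤ (h x - h x₀) / δ := div_nonneg (by linarith [hmin x hx]) hδ.le
      have hy1 : 0 ≤ (h y - h x₀) / δ := div_nonneg (by linarith [hmin y hy]) hδ.le
      have a1 := Nat.floor_le hx1
      have a2 := Nat.lt_floor_add_one ((h x - h x₀) / δ)
      have b1 := Nat.floor_le hy1
      have b2 := Nat.lt_floor_add_one ((h y - h x₀) / δ)
      simp only at hxy
      rw [hxy] at a1 a2
      have h2 : |(h x - h x₀) / δ - (h y - h x₀) / δ| < 1 := by
        rw [abs_lt]; constructor <;> linarith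
      rw [← sub_div, abs_div, abs_of_pos hδ, div_lt_one hδ] at h2
      have : h x - h x₀ - (h y - h x₀) = h x - h y := by ring
      rw [this] at h2
      linarith
  rw [Finset.card_range] at hle
  calc (S.card : ℝ) ≤ ((⌊X / δ⌋₊ + 1 : ℕ) : ℝ) := by exact_mod_cast hle
    _ = ⌊X / δ⌋₊ + 1 := by push_cast; ring
    _ ≤ X / δ + 1 := by gcongr; exact Nat.floor_le (by positivity)
    _ = _ := by ring

/-- A finite set of integers within distance `r` of `c` has at most `2 r + 1` elements. -/
lemma card_int_le {α : Type*} (S : Finset α) (k : α → ℤ) (hk : Set.InjOn k S) {c r : ℝ}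
    (hr : 0 ≤ r) (h : ∀ x ∈ S, |(k x : ℝ) - c| ≤ r) : (S.card : ℝ) ≤ 2 * r + 1 := by
  have := card_le_of_separated S (fun x => (k x : ℝ)) (δ := 1) (X := 2 * r) one_pos (by linarith)
    (fun x hx y hy => by
      have h1 := abs_le.1 (h x hx)
      have h2 := abs_le.1 (h y hy)
      linarith)
    (fun x hx y hy hxy => by
      have : k x - k y ≠ 0 := fun h0 => hxy (hk hx hy (by omega))
      have := Int.one_le_abs this
      exact_mod_cast this)
  linarith [div_one (2 * r)]

/-- A geometric sum with ratio `r > 1` is dominated by its largest term. -/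
lemma sum_pow_le_of_pow_le (J : Finset ℕ) {r M : ℝ} (hr : 1 < r) (hM : 0 ≤ M)
    (h : ∀ j ∈ J, r ^ j ≤ M) : ∑ j ∈ J, r ^ j ≤ M * (r / (r - 1)) := by
  have hr1 : 0 < r - 1 := by linarith
  rcases J.eq_empty_or_nonempty with rfl | hne
  · simp; positivity
  have hsub : J ⊆ Finset.range (J.max' hne + 1) := fun j hj =>
    Finset.mem_range.2 (Nat.lt_succ_of_le (J.le_max' j hj))
  calc ∑ j ∈ J, r ^ j ≤ ∑ j ∈ Finset.range (J.max' hne + 1), r ^ j :=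
        Finset.sum_le_sum_of_subset_of_nonneg hsub (fun _ _ _ => by positivity)
    _ = (r ^ (J.max' hne + 1) - 1) / (r - 1) := geom_sum_eq hr.ne' _
    _ ≤ (r ^ (J.max' hne) * r) / (r - 1) := by
        gcongr
        rw [pow_succ]; linarith
    _ ≤ (M * r) / (r - 1) := by
        gcongr
        exact h _ (J.max'_mem hne)
    _ = _ := by ring

/-- A triple of integers is primitive if its entries generate the unit ideal. -/
def IsPrimitive (v : ℤ × ℤ × ℤ) : Prop :=
  ∃ r₁ r₂ r₃ : ℤ, r₁ * v.1 + r₂ * v.2.1 + r₃ * v.2.2 = 1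

/-- The rational point `(a / q, b / q)` encoded by `(q, a, b)` lies on the line
`u y = m x - n` encoded by `(u, m, n)`. -/
def Incident (v w : ℤ × ℤ × ℤ) : Prop :=
  w.1 * v.2.2 + v.1 * w.2.2 = v.2.1 * w.2.1

lemma exists_isPrimitive_mul (x y z : ℤ) (h : ¬ (x = 0 ∧ y = 0 ∧ z = 0)) :
    ∃ (g : ℤ) (w : ℤ × ℤ × ℤ), 0 < g ∧ IsPrimitive w ∧ x = g * w.1 ∧ y = g * w.2.1 ∧
      z = g * w.2.2 := by
  set e : ℕ := Int.gcd y z with he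
  set g : ℕ := Int.gcd x e with hg
  have hg0 : g ≠ 0 := by
    intro h0
    rw [hg, Int.gcd_eq_zero_iff] at h0
    obtain ⟨hx, he0⟩ := h0
    have he0' : e = 0 := by exact_mod_cast he0
    rw [he, Int.gcd_eq_zero_iff] at he0'
    exact h ⟨hx, he0'.1, he0'.2⟩
  have hgx : (g : ℤ) ∣ x := Int.gcd_dvd_left ..
  have hge : (g : ℤ) ∣ e := Int.gcd_dvd_right ..
  have hgy : (g : ℤ) ∣ y := hge.trans (Int.gcd_dvd_left ..)
  have hgz : (g : ℤ) ∣ z := hge.trans (Int.gcd_dvd_right ..)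
  obtain ⟨x', hx'⟩ := hgx
  obtain ⟨y', hy'⟩ := hgy
  obtain ⟨z', hz'⟩ := hgz
  have b1 := Int.gcd_eq_gcd_ab y z
  have b2 := Int.gcd_eq_gcd_ab x e
  rw [← hg] at b2
  rw [← he] at b1
  refine ⟨g, (x', y', z'), by positivity, ?_, hx', hy', hz'⟩
  refine ⟨Int.gcdA x e, Int.gcdA y z * Int.gcdB x e, Int.gcdB y z * Int.gcdB x e, ?_⟩
  have hgz' : (g : ℤ) ≠ 0 := by exact_mod_cast hg0
  apply mul_left_cancel₀ hgz'
  simp only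
  calc (g : ℤ) * (Int.gcdA x e * x' + Int.gcdA y z * Int.gcdB x e * y' +
        Int.gcdB y z * Int.gcdB x e * z')
      = (g * x') * Int.gcdA x e + ((g * y') * Int.gcdA y z + (g * z') * Int.gcdB y z) *
        Int.gcdB x e := by ring
    _ = g * 1 := by rw [← hx', ← hy', ← hz', ← b1, ← b2, mul_one]

/-- Primitive triples with positive first entry are determined by the rational point they encode. -/
lemma IsPrimitive.eq_of_cross_eq {v v' : ℤ × ℤ × ℤ} (hv : IsPrimitive v) (hv' : IsPrimitive v')
    (hq : 0 < v.1) (hq' : 0 < v'.1) (h₁ : v.1 * v'.2.1 = v.2.1 * v'.1)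
    (h₂ : v.1 * v'.2.2 = v.2.2 * v'.1) : v = v' := by
  obtain ⟨q, a, b⟩ := v
  obtain ⟨q', a', b'⟩ := v'
  obtain ⟨r₁, r₂, r₃, hr⟩ := hv
  obtain ⟨s₁, s₂, s₃, hs⟩ := hv'
  simp only at *
  have d1 : q ∣ q' := ⟨r₁ * q' + r₂ * a' + r₃ * b',
    by linear_combination -q' * hr - r₂ * h₁ - r₃ * h₂⟩
  have d2 : q' ∣ q := ⟨s₁ * q + s₂ * a + s₃ * b, by linear_combination -q * hs + s₂ * h₁ + s₃ * h₂⟩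
  have e : q = q' := Int.dvd_antisymm hq.le hq'.le d1 d2
  subst e
  have ha : a' = a := mul_left_cancel₀ hq.ne' (by linarith [mul_comm a q])
  have hb : b' = b := mul_left_cancel₀ hq.ne' (by linarith [mul_comm b q])
  rw [ha, hb]

/-- Two distinct rational points lie on a common non-zero rational line. -/
lemma exists_line {v v' : ℤ × ℤ × ℤ} (hv : IsPrimitive v) (hv' : IsPrimitive v')
    (hq : 0 < v.1) (hq' : 0 < v'.1) (hne : v ≠ v') :
    ∃ w : ℤ × ℤ × ℤ, IsPrimitive w ∧ 0 ≤ w.1 ∧ Incident v w ∧ Incident v' w := by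
  have key : ∀ v v' : ℤ × ℤ × ℤ, IsPrimitive v → IsPrimitive v' → 0 < v.1 → 0 < v'.1 → v ≠ v' →
      0 ≤ v.1 * v'.2.1 - v.2.1 * v'.1 →
      ∃ w : ℤ × ℤ × ℤ, IsPrimitive w ∧ 0 ≤ w.1 ∧ Incident v w ∧ Incident v' w := by
    intro v v' hv hv' hq hq' hne hpos
    obtain ⟨g, w, hg, hw, h1, h2, h3⟩ := exists_isPrimitive_mul (v.1 * v'.2.1 - v.2.1 * v'.1)
      (v.1 * v'.2.2 - v.2.2 * v'.1) (v.2.1 * v'.2.2 - v.2.2 * v'.2.1) (by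
        rintro ⟨h1, h2, -⟩
        exact hne (hv.eq_of_cross_eq hv' hq hq' (by linarith) (by linarith)))
    refine ⟨w, hw, ?_, ?_, ?_⟩
    · rw [h1] at hpos
      exact nonneg_of_mul_nonneg_right hpos hg
    · refine mul_left_cancel₀ hg.ne' ?_
      linear_combination v.2.1 * h2 - v.2.2 * h1 - v.1 * h3
    · refine mul_left_cancel₀ hg.ne' ?_
      linear_combination v'.2.1 * h2 - v'.2.2 * h1 - v'.1 * h3
  rcases le_total 0 (v.1 * v'.2.1 - v.2.1 * v'.1) with h | h
  · exact key v v' hv hv' hq hq' hne h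
  · obtain ⟨w, h1, h2, h3, h4⟩ := key v' v hv' hv hq' hq hne.symm (by linarith)
    exact ⟨w, h1, h2, h4, h3⟩

/-- Distinct rational points with denominators at most `Q` on a common primitive line are separated
in proportion to the height of the line. -/
lemma separation_of_incident {v v' w : ℤ × ℤ × ℤ} {Q : ℝ} (hv : IsPrimitive v)
    (hv' : IsPrimitive v') (hw : IsPrimitive w) (hq : 0 < v.1) (hq' : 0 < v'.1)
    (hqQ : (v.1 : ℝ) ≤ Q) (hqQ' : (v'.1 : ℝ) ≤ Q) (hne : v ≠ v')
    (hi : Incident v w) (hi' : Incident v' w) :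
    |(w.1 : ℝ)| / Q ^ 2 ≤ |(v.2.1 : ℝ) / v.1 - v'.2.1 / v'.1| ∧
    |(w.2.1 : ℝ)| / Q ^ 2 ≤ |(v.2.2 : ℝ) / v.1 - v'.2.2 / v'.1| := by
  obtain ⟨r₁, r₂, r₃, hr⟩ := hw
  unfold Incident at hi hi'
  set j : ℤ := r₁ * (v.1 * v'.2.1 - v.2.1 * v'.1) + r₂ * (v.1 * v'.2.2 - v.2.2 * v'.1) +
    r₃ * (v.2.1 * v'.2.2 - v.2.2 * v'.2.1) with hj
  have h1 : v.1 * v'.2.1 - v.2.1 * v'.1 = w.1 * j := by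
    rw [hj]
    linear_combination (-(v.1 * v'.2.1 - v.2.1 * v'.1)) * hr - r₂ * (v.1 * hi' - v'.1 * hi) -
      r₃ * (v.2.1 * hi' - v'.2.1 * hi)
  have h2 : v.1 * v'.2.2 - v.2.2 * v'.1 = w.2.1 * j := by
    rw [hj]
    linear_combination (-(v.1 * v'.2.2 - v.2.2 * v'.1)) * hr + r₁ * (v.1 * hi' - v'.1 * hi) -
      r₃ * (v.2.2 * hi' - v'.2.2 * hi)
  have hj0 : j ≠ 0 := by
    intro h0
    rw [h0, mul_zero] at h1 h2
    exact hne (hv.eq_of_cross_eq hv' hq hq' (by linarith) (by linarith))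
  have hj1 : (1 : ℝ) ≤ |(j : ℝ)| := by exact_mod_cast Int.one_le_abs hj0
  have hqr : (0 : ℝ) < v.1 := by exact_mod_cast hq
  have hqr' : (0 : ℝ) < v'.1 := by exact_mod_cast hq'
  have hprod : (v.1 : ℝ) * v'.1 ≤ Q ^ 2 := by
    rw [sq]; exact mul_le_mul hqQ hqQ' hqr'.le (hqr.le.trans hqQ)
  have main : ∀ (k : ℤ) (a a' : ℤ), v.1 * a' - a * v'.1 = k * j →
      |(k : ℝ)| / Q ^ 2 ≤ |(a : ℝ) / v.1 - a' / v'.1| := by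
    intro k a a' hk
    have e : (a : ℝ) / v.1 - a' / v'.1 = -(k * j / (v.1 * v'.1)) := by
      have : (v.1 : ℝ) * a' - a * v'.1 = k * j := by exact_mod_cast hk
      rw [← this]; field_simp; ring
    rw [e, abs_neg, abs_div, abs_mul, abs_of_pos (mul_pos hqr hqr')]
    calc |(k : ℝ)| / Q ^ 2 ≤ |(k : ℝ)| / (v.1 * v'.1) := by gcongr
      _ ≤ |(k : ℝ)| * |(j : ℝ)| / (v.1 * v'.1) := by
        gcongr
        exact le_mul_of_one_le_right (abs_nonneg _) hj1
  exact ⟨main _ _ _ h1, main _ _ _ h2⟩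

/-- Two strictly convex functions `f`, `g` that are Legendre transforms of each other, with mutually
inverse gradients `φ`, `χ`. All bi-Lipschitz and convexity constants are controlled by `K`. -/
structure DualPair (K : ℝ) (f g φ χ : ℝ → ℝ) : Prop where
  one_le : 1 ≤ K
  left_inv : ∀ x, χ (φ x) = x
  right_inv : ∀ y, φ (χ y) = y
  mono : Monotone φ
  mono' : Monotone χ
  lip : ∀ x x', |φ x - φ x'| ≤ K * |x - x'|
  lip' : ∀ y y', |χ y - χ y'| ≤ K * |y - y'|
  lower : ∀ x y, (y - φ x) ^ 2 ≤ K * (f x + g y - x * y)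
  upper : ∀ x y, f x + g y - x * y ≤ K * (y - φ x) ^ 2
  lower' : ∀ x y, (x - χ y) ^ 2 ≤ K * (f x + g y - x * y)
  upper' : ∀ x y, f x + g y - x * y ≤ K * (x - χ y) ^ 2

namespace DualPair

variable {K : ℝ} {f g φ χ : ℝ → ℝ}

lemma symm (h : DualPair K f g φ χ) : DualPair K g f χ φ where
  one_le := h.one_le
  left_inv := h.right_inv
  right_inv := h.left_inv
  mono := h.mono'
  mono' := h.mono
  lip := h.lip'
  lip' := h.lip
  lower y x := by have := h.lower' x y; rwa [add_comm (f x), mul_comm x] at this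
  upper y x := by have := h.upper' x y; rwa [add_comm (f x), mul_comm x] at this
  lower' y x := by have := h.lower x y; rwa [add_comm (f x), mul_comm x] at this
  upper' y x := by have := h.upper x y; rwa [add_comm (f x), mul_comm x] at this

lemma pos (h : DualPair K f g φ χ) : 0 < K := by linarith [h.one_le]

lemma defect_nonneg (h : DualPair K f g φ χ) (x y : ℝ) : 0 ≤ f x + g y - x * y :=
  nonneg_of_mul_nonneg_right ((sq_nonneg _).trans (h.lower x y)) h.pos

lemma defect_eq_zero (h : DualPair K f g φ χ) (x : ℝ) : f x + g (φ x) - x * φ x = 0 :=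
  le_antisymm (by simpa using h.upper x (φ x)) (h.defect_nonneg _ _)

/-- The first-order Taylor remainder of `f` is the defect at the gradient. -/
lemma sub_eq (h : DualPair K f g φ χ) (x x' : ℝ) :
    f x' - f x = (f x' + g (φ x) - x' * φ x) + φ x * (x' - x) := by
  linear_combination -(h.defect_eq_zero x)

/-- Two points near a line, on the same side of the point of tangency, are close to each other. -/
lemma mul_abs_sub_le (h : DualPair K f g φ χ) {σ d ρ x x' : ℝ}
    (hx : |f x + g σ - x * σ - d| ≤ ρ) (hx' : |f x' + g σ - x' * σ - d| ≤ ρ)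
    (hside : (χ σ ≤ x ∧ x ≤ x') ∨ (x' ≤ x ∧ x ≤ χ σ)) :
    |σ - φ x| * |x' - x| ≤ 2 * ρ := by
  have h1 := abs_le.1 hx
  have h2 := abs_le.1 hx'
  have h3 := h.sub_eq x x'
  have h4 := h.defect_nonneg x' (φ x)
  have h5 : |σ - φ x| * |x' - x| = (φ x - σ) * (x' - x) := by
    rcases hside with ⟨ha, hb⟩ | ⟨ha, hb⟩
    · have := h.mono ha
      rw [h.right_inv] at this
      rw [abs_of_nonpos (by linarith), abs_of_nonneg (by linarith)]; ring
    · have := h.mono hb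
      rw [h.right_inv] at this
      rw [abs_of_nonneg (by linarith), abs_of_nonpos (by linarith)]; ring
  rw [h5]
  nlinarith

/-- Two points near a line that are close to each other have controlled secant. -/
lemma mul_abs_sub_le_of_close (h : DualPair K f g φ χ) {σ d ρ x x' L : ℝ}
    (hx : |f x + g σ - x * σ - d| ≤ ρ) (hx' : |f x' + g σ - x' * σ - d| ≤ ρ)
    (hL : |x' - x| ≤ L) (hKL : K * L ^ 2 ≤ ρ) :
    |σ - φ x| * |x' - x| ≤ 3 * ρ := by
  have h1 := abs_le.1 hx
  have h2 := abs_le.1 hx'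
  have h3 := h.sub_eq x x'
  have h4 := h.defect_nonneg x' (φ x)
  have h5 := h.upper' x' (φ x)
  rw [h.left_inv] at h5
  have h6 : (x' - x) ^ 2 ≤ L ^ 2 := by
    rw [← sq_abs (x' - x)]; gcongr
  have h7 : K * (x' - x) ^ 2 ≤ ρ := (mul_le_mul_of_nonneg_left h6 h.pos.le).trans hKL
  rw [← abs_mul, abs_le]
  constructor <;> nlinarith

end DualPair

/-- The primitive triple `(q, a, b)` encodes a rational point of denominator at most `Q` at vertical
distance at most `ρ` from the graph of `f` over the window of radius one around `z`. -/
structure Near (f : ℝ → ℝ) (Q : ℕ) (ρ z : ℝ) (v : ℤ × ℤ × ℤ) : Prop where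
  prim : IsPrimitive v
  pos : 0 < v.1
  le : (v.1 : ℝ) ≤ Q
  window : |(v.2.1 : ℝ) / v.1 - z| ≤ 1
  close : |(v.2.2 : ℝ) / v.1 - f (v.2.1 / v.1)| ≤ ρ

lemma Near.pos_Q {f : ℝ → ℝ} {Q : ℕ} {ρ z : ℝ} {v : ℤ × ℤ × ℤ} (h : Near f Q ρ z v) :
    (0 : ℝ) < Q := lt_of_lt_of_le (by exact_mod_cast h.pos) h.le

lemma Near.mono {f : ℝ → ℝ} {Q : ℕ} {ρ ρ' z : ℝ} {v : ℤ × ℤ × ℤ} (h : Near f Q ρ z v)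
    (hρ : ρ ≤ ρ') : Near f Q ρ' z v :=
  ⟨h.prim, h.pos, h.le, h.window, h.close.trans hρ⟩

/-- On a line `y = σ x - n / u`, the defect differs from the offset by the distance to the curve. -/
lemma Near.defect {f g : ℝ → ℝ} {Q : ℕ} {ρ z : ℝ} {v w : ℤ × ℤ × ℤ} (h : Near f Q ρ z v)
    (hi : Incident v w) (hu : 0 < w.1) :
    |f (v.2.1 / v.1) + g (w.2.1 / w.1) - v.2.1 / v.1 * (w.2.1 / w.1) -
      (g (w.2.1 / w.1) - w.2.2 / w.1)| ≤ ρ := by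
  have hq : (0 : ℝ) < v.1 := by exact_mod_cast h.pos
  have hu' : (0 : ℝ) < w.1 := by exact_mod_cast hu
  have hi' : (w.1 : ℝ) * v.2.2 + v.1 * w.2.2 = v.2.1 * w.2.1 := by exact_mod_cast hi
  have e : (v.2.2 : ℝ) / v.1 = v.2.1 / v.1 * (w.2.1 / w.1) - w.2.2 / w.1 := by
    field_simp; linarith
  have := h.close
  rw [e, abs_sub_comm] at this
  convert this using 2
  ring

variable {K : ℝ} {f g φ χ : ℝ → ℝ}

/-- The number of rational points near the curve on a given non-vertical line. -/
lemma DualPair.card_line_le (h : DualPair K f g φ χ) {Q : ℕ} {ρ z r : ℝ} (hρ : 0 < ρ)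
    {w : ℤ × ℤ × ℤ} (hw : IsPrimitive w) (hu : 0 < w.1) (hr : 0 < r)
    (hr2 : r ^ 2 = max |g (w.2.1 / w.1) - w.2.2 / w.1| ρ) (T : Finset (ℤ × ℤ × ℤ))
    (hT : ∀ v ∈ T, Near f Q ρ z v ∧ Incident v w) :
    (T.card : ℝ) ≤ 2 + 6 * K * (ρ * Q ^ 2) / (w.1 * r) := by
  rcases T.eq_empty_or_nonempty with rfl | ⟨v₀, hv₀⟩
  · have := h.pos
    have : (0 : ℝ) < w.1 := by exact_mod_cast hu
    simp; positivity
  have hQ : (0 : ℝ) < Q := (hT v₀ hv₀).1.pos_Q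
  have hu' : (0 : ℝ) < w.1 := by exact_mod_cast hu
  have hK := h.pos
  have hK1 := h.one_le
  set σ : ℝ := w.2.1 / w.1 with hσ
  set d : ℝ := g σ - w.2.2 / w.1 with hd
  set X : ℤ × ℤ × ℤ → ℝ := fun v => v.2.1 / v.1 with hXdef
  have hdef : ∀ v ∈ T, |f (X v) + g σ - X v * σ - d| ≤ ρ := fun v hv =>
    (hT v hv).1.defect (hT v hv).2 hu
  have key : ∀ x x', |f x + g σ - x * σ - d| ≤ ρ → |f x' + g σ - x' * σ - d| ≤ ρ →
      ((χ σ ≤ x ∧ x ≤ x') ∨ (x' ≤ x ∧ x ≤ χ σ)) → |x' - x| ≤ 3 * K * ρ / r := by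
    intro x x' hx hx' hside
    rw [le_div_iff₀ hr]
    refine abs_le_of_sq_le_sq' (a := |x' - x| * r) ?_ (by positivity) |>.2
    rw [mul_pow, sq_abs, hr2]
    have hxa := abs_le.1 hx
    have hxa' := abs_le.1 hx'
    have hn := h.defect_nonneg x' σ
    rcases le_or_gt d (2 * ρ) with hc | hc
    · have h1 : max |d| ρ ≤ 2 * ρ := max_le (abs_le.2 ⟨by linarith, hc⟩) (by linarith)
      have h2 : (x' - x) ^ 2 ≤ (x' - χ σ) ^ 2 := by
        rcases hside with ⟨ha, hb⟩ | ⟨ha, hb⟩ <;> nlinarith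
      have h3 := h.lower' x' σ
      have h4 : (x' - x) ^ 2 ≤ K * (3 * ρ) := h2.trans (h3.trans (by gcongr; linarith))
      calc (x' - x) ^ 2 * max |d| ρ ≤ (K * (3 * ρ)) * (2 * ρ) := by gcongr
        _ = 6 * K * ρ ^ 2 := by ring
        _ ≤ (3 * K * ρ) ^ 2 := by
          have : 0 ≤ ρ ^ 2 := sq_nonneg _
          nlinarith [mul_nonneg (mul_nonneg hK.le (by linarith : 0 ≤ K - 1)) this,
            mul_nonneg hK.le this]
    · have h1 : max |d| ρ = d := by
        rw [abs_of_pos (by linarith)]; exact max_eq_left (by linarith)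
      rw [h1]
      have h2 := h.mul_abs_sub_le hx hx' hside
      have h3 := h.upper x σ
      have h4 : (σ - φ x) ^ 2 * (x' - x) ^ 2 ≤ 4 * ρ ^ 2 := by
        have := pow_le_pow_left₀ (by positivity) h2 2
        rw [mul_pow, sq_abs, sq_abs] at this
        linarith
      have h5 : d ≤ 2 * K * (σ - φ x) ^ 2 := by linarith
      calc (x' - x) ^ 2 * d ≤ (x' - x) ^ 2 * (2 * K * (σ - φ x) ^ 2) := by gcongr
        _ = 2 * K * ((σ - φ x) ^ 2 * (x' - x) ^ 2) := by ring
        _ ≤ 2 * K * (4 * ρ ^ 2) := by gcongr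
        _ ≤ (3 * K * ρ) ^ 2 := by
          have : 0 ≤ ρ ^ 2 := sq_nonneg _
          nlinarith [mul_nonneg (mul_nonneg hK.le (by linarith : 0 ≤ K - 1)) this,
            mul_nonneg hK.le this]
  have hside : ∀ (p : ℝ → Prop) [DecidablePred p], (∀ x x', p x → p x' → x ≤ x' →
        ((χ σ ≤ x ∧ x ≤ x') ∨ (x ≤ x' ∧ x' ≤ χ σ))) →
      ((T.filter (fun v => p (X v))).card : ℝ) ≤ 1 + 3 * K * (ρ * Q ^ 2) / (w.1 * r) := by
    intro p _ hp
    have hb := card_le_of_separated (T.filter (fun v => p (X v))) X (δ := w.1 / (Q : ℝ) ^ 2)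
      (X := 3 * K * ρ / r) (by positivity) (by positivity) ?_ ?_
    · refine hb.trans (le_of_eq ?_)
      field_simp
    · intro v hv v' hv'
      rw [Finset.mem_filter] at hv hv'
      rcases le_total (X v) (X v') with hle | hle
      · exact le_trans (by linarith) (by positivity : (0 : ℝ) ≤ 3 * K * ρ / r)
      · rcases hp _ _ hv'.2 hv.2 hle with hs | hs
        · exact (le_abs_self _).trans
            (key _ _ (hdef _ hv'.1) (hdef _ hv.1) (Or.inl hs))
        · have := key _ _ (hdef _ hv.1) (hdef _ hv'.1) (Or.inr hs)
          rw [abs_sub_comm] at this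
          exact (le_abs_self _).trans this
    · intro v hv v' hv' hne
      rw [Finset.mem_filter] at hv hv'
      obtain ⟨n1, i1⟩ := hT v hv.1
      obtain ⟨n2, i2⟩ := hT v' hv'.1
      have := (separation_of_incident n1.prim n2.prim hw n1.pos n2.pos n1.le n2.le hne i1 i2).1
      rwa [abs_of_pos hu'] at this
  have h1 := hside (fun x => χ σ ≤ x) (fun x x' hx _ hxx => Or.inl ⟨hx, hxx⟩)
  have h2 := hside (fun x => ¬ χ σ ≤ x)
    (fun x x' _ hx' hxx => Or.inr ⟨hxx, by linarith [not_le.1 hx']⟩)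
  have h3 := Finset.card_filter_add_card_filter_not (s := T) (fun v => χ σ ≤ X v)
  have h4 : (T.card : ℝ) = (T.filter (fun v => χ σ ≤ X v)).card +
      (T.filter (fun v => ¬ χ σ ≤ X v)).card := by exact_mod_cast h3.symm
  rw [h4]
  calc _ ≤ (1 + 3 * K * (ρ * Q ^ 2) / (w.1 * r)) + (1 + 3 * K * (ρ * Q ^ 2) / (w.1 * r)) :=
        add_le_add h1 h2
    _ = _ := by ring

/-- Constraints on a non-vertical line through two close rational points near the curve. -/
lemma DualPair.line_constraints (h : DualPair K f g φ χ) {Q : ℕ} {ρ z L : ℝ} (hρ : 0 < ρ)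
    {v v' w : ℤ × ℤ × ℤ} (hw : IsPrimitive w) (hu : 0 < w.1)
    (hv : Near f Q ρ z v) (hv' : Near f Q ρ z v') (hne : v ≠ v')
    (hi : Incident v w) (hi' : Incident v' w)
    (hL : |(v.2.1 : ℝ) / v.1 - v'.2.1 / v'.1| ≤ L) (hKL : K * L ^ 2 ≤ ρ) :
    (w.1 : ℝ) ≤ L * Q ^ 2 ∧
    w.1 * |(w.2.1 : ℝ) / w.1 - φ (v.2.1 / v.1)| ≤ 3 * (ρ * Q ^ 2) ∧
    (w.1 : ℝ) ^ 2 * max |g (w.2.1 / w.1) - w.2.2 / w.1| ρ ≤ (4 * K * (ρ * Q ^ 2)) ^ 2 := by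
  have hQ : (0 : ℝ) < Q := hv.pos_Q
  have hu' : (0 : ℝ) < w.1 := by exact_mod_cast hu
  have hK := h.pos
  have hK1 := h.one_le
  have hs := (separation_of_incident hv.prim hv'.prim hw hv.pos hv'.pos hv.le hv'.le hne hi hi').1
  rw [abs_of_pos hu', div_le_iff₀ (by positivity)] at hs
  have hL0 : 0 ≤ L := (abs_nonneg _).trans hL
  have d1 := hv.defect (g := g) hi hu
  have d2 := hv'.defect (g := g) hi' hu
  have hc := h.mul_abs_sub_le_of_close d1 d2 (by rwa [abs_sub_comm]) hKL
  set σ : ℝ := w.2.1 / w.1 with hσ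
  set d : ℝ := g σ - w.2.2 / w.1 with hd
  set x : ℝ := v.2.1 / v.1
  set x' : ℝ := v'.2.1 / v'.1
  rw [abs_sub_comm x' x] at hc
  have c1 : (w.1 : ℝ) ≤ L * Q ^ 2 := hs.trans (by gcongr)
  have c2 : w.1 * |σ - φ x| ≤ 3 * (ρ * Q ^ 2) := by
    calc w.1 * |σ - φ x| ≤ (|x - x'| * Q ^ 2) * |σ - φ x| := by gcongr
      _ = (|σ - φ x| * |x - x'|) * Q ^ 2 := by ring
      _ ≤ 3 * ρ * Q ^ 2 := by gcongr
      _ = _ := by ring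
  refine ⟨c1, c2, ?_⟩
  have hL2 : L ^ 2 ≤ ρ := le_trans (by nlinarith [sq_nonneg L]) hKL
  have c3 : (w.1 : ℝ) ^ 2 * ρ ≤ (ρ * Q ^ 2) ^ 2 := by
    calc (w.1 : ℝ) ^ 2 * ρ ≤ (L * Q ^ 2) ^ 2 * ρ := by gcongr
      _ = L ^ 2 * (Q ^ 4 * ρ) := by ring
      _ ≤ ρ * (Q ^ 4 * ρ) := by gcongr
      _ = _ := by ring
  have hm : max |d| ρ ≤ K * (σ - φ x) ^ 2 + ρ := by
    have a1 := abs_le.1 d1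
    have a2 := h.upper x σ
    have a3 := h.defect_nonneg x σ
    have a4 : 0 ≤ K * (σ - φ x) ^ 2 := by positivity
    exact max_le (abs_le.2 ⟨by linarith, by linarith⟩) (by linarith)
  calc (w.1 : ℝ) ^ 2 * max |d| ρ ≤ (w.1 : ℝ) ^ 2 * (K * (σ - φ x) ^ 2 + ρ) := by gcongr
    _ = K * (w.1 * |σ - φ x|) ^ 2 + (w.1 : ℝ) ^ 2 * ρ := by rw [mul_pow, sq_abs]; ring
    _ ≤ K * (3 * (ρ * Q ^ 2)) ^ 2 + (ρ * Q ^ 2) ^ 2 := by gcongr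
    _ ≤ (4 * K * (ρ * Q ^ 2)) ^ 2 := by
      have : 0 ≤ (ρ * Q ^ 2) ^ 2 := sq_nonneg _
      nlinarith [mul_nonneg (mul_nonneg hK.le (by linarith : 0 ≤ K - 1)) this,
            mul_nonneg hK.le this, mul_nonneg (by linarith : 0 ≤ K - 1) this]

/-- The line `w` passes through two distinct elements of `S` at horizontal distance at most `L`. -/
structure IsJoining (S : Finset (ℤ × ℤ × ℤ)) (L : ℝ) (w : ℤ × ℤ × ℤ) : Prop where
  prim : IsPrimitive w
  nonneg : 0 ≤ w.1
  exists_pair : ∃ v ∈ S, ∃ v' ∈ S, v ≠ v' ∧ Incident v w ∧ Incident v' w ∧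
    |(v.2.1 : ℝ) / v.1 - v'.2.1 / v'.1| ≤ L

/-- The line `w` is nowhere close to being tangent to the curve over the window around `z`. -/
def IsTransversal (χ : ℝ → ℝ) (z : ℝ) (w : ℤ × ℤ × ℤ) : Prop :=
  w.1 = 0 ∨ 2 < |χ (w.2.1 / w.1) - z|

lemma abs_sub_mul_eq {u : ℝ} (hu : 0 < u) (m y : ℝ) : |m - u * y| = u * |m / u - y| := by
  rw [← abs_of_pos hu, ← abs_mul, abs_of_pos hu]
  congr 1
  field_simp

lemma DualPair.le_of_isTransversal (h : DualPair K f g φ χ) {z : ℝ} {v w : ℤ × ℤ × ℤ}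
    (hw : IsPrimitive w) (hu : 0 ≤ w.1) (hfar : IsTransversal χ z w) (hq : 0 < v.1)
    (hi : Incident v w) :
    (w.1 : ℝ) ≤ K * |w.2.1 - w.1 * φ z| ∧ 1 ≤ K * |w.2.1 - w.1 * φ z| := by
  have hK1 := h.one_le
  rcases hu.eq_or_lt with h0 | hpos
  · rw [← h0]
    simp only [Int.cast_zero, zero_mul, sub_zero]
    have hm : w.2.1 ≠ 0 := by
      intro hm
      unfold Incident at hi
      rw [← h0, hm] at hi
      have hn : w.2.2 = 0 := by
        have : v.1 * w.2.2 = 0 := by linarith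
        exact (mul_eq_zero.1 this).resolve_left hq.ne'
      obtain ⟨r₁, r₂, r₃, hr⟩ := hw
      rw [← h0, hm, hn] at hr
      simp at hr
    have hm1 : (1 : ℝ) ≤ |(w.2.1 : ℝ)| := by exact_mod_cast Int.one_le_abs hm
    exact ⟨by positivity, by nlinarith⟩
  · have hu' : (0 : ℝ) < w.1 := by exact_mod_cast hpos
    have hu1 : (1 : ℝ) ≤ w.1 := by exact_mod_cast hpos
    have hf : 2 < |χ (w.2.1 / w.1) - z| := hfar.resolve_left hpos.ne'
    have h1 := h.lip' (w.2.1 / w.1) (φ z)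
    rw [h.left_inv] at h1
    rw [abs_sub_mul_eq hu']
    have h2 : 1 ≤ K * |(w.2.1 : ℝ) / w.1 - φ z| := by linarith
    constructor <;> nlinarith

/-- On a transversal line the slope difference is essentially constant over the window. -/
lemma DualPair.slope_le_of_isTransversal (h : DualPair K f g φ χ) {z x σ : ℝ}
    (hf : 2 < |χ σ - z|) (hx : |x - z| ≤ 1) : |σ - φ z| ≤ (1 + K ^ 2) * |σ - φ x| := by
  have h1 := h.lip' σ (φ x)
  rw [h.left_inv] at h1
  have h2 : 1 ≤ |χ σ - x| := by
    have := abs_sub_le (χ σ) x z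
    linarith
  have h3 := h.lip x z
  have h4 := abs_sub_le σ (φ x) (φ z)
  have hK := h.pos
  have h5 : K * |x - z| ≤ K := by nlinarith
  have h6 : K * 1 ≤ K * (K * |σ - φ x|) := by gcongr; linarith
  nlinarith

lemma DualPair.card_transversal_line_le (h : DualPair K f g φ χ) {Q : ℕ} {ρ z : ℝ} (hρ : 0 < ρ)
    {w : ℤ × ℤ × ℤ} (hw : IsPrimitive w) (hu : 0 ≤ w.1) (hfar : IsTransversal χ z w)
    (T : Finset (ℤ × ℤ × ℤ)) (hT : ∀ v ∈ T, Near f Q ρ z v ∧ Incident v w) :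
    (T.card : ℝ) ≤ 1 + 2 * (1 + K ^ 2) * (ρ * Q ^ 2) / |w.2.1 - w.1 * φ z| := by
  rcases T.eq_empty_or_nonempty with rfl | ⟨v₀, hv₀⟩
  · simp; positivity
  have hQ : (0 : ℝ) < Q := (hT v₀ hv₀).1.pos_Q
  have hK := h.pos
  have hθ := (h.le_of_isTransversal hw hu hfar (hT v₀ hv₀).1.pos (hT v₀ hv₀).2).2
  set θ : ℝ := |w.2.1 - w.1 * φ z| with hθdef
  have hθ0 : 0 < θ := by
    by_contra hneg
    nlinarith [abs_nonneg ((w.2.1 : ℝ) - w.1 * φ z)]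
  have hE : 0 < 1 + K ^ 2 := by positivity
  rcases hu.eq_or_lt with h0 | hpos
  · have hb := card_le_of_separated T (fun v => (v.2.2 : ℝ) / v.1) (δ := θ / (Q : ℝ) ^ 2)
      (X := 2 * ρ) (by positivity) (by positivity) ?_ ?_
    · refine hb.trans ?_
      have : 2 * ρ / (θ / (Q : ℝ) ^ 2) = 2 * 1 * (ρ * Q ^ 2) / θ := by field_simp
      rw [this]
      gcongr
      nlinarith
    · intro v hv v' hv'
      obtain ⟨n1, i1⟩ := hT v hv
      obtain ⟨n2, i2⟩ := hT v' hv'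
      have hm : w.2.1 ≠ 0 := by
        intro hm
        rw [hθdef, hm, ← h0] at hθ0
        simp at hθ0
      have hx : (v.2.1 : ℝ) / v.1 = v'.2.1 / v'.1 := by
        have q1 : (0 : ℝ) < v.1 := by exact_mod_cast n1.pos
        have q2 : (0 : ℝ) < v'.1 := by exact_mod_cast n2.pos
        rw [div_eq_div_iff q1.ne' q2.ne']
        unfold Incident at i1 i2
        rw [← h0] at i1 i2
        have : w.2.1 * (v.2.1 * v'.1) = w.2.1 * (v'.2.1 * v.1) := by
          linear_combination v.1 * i2 - v'.1 * i1
        exact_mod_cast mul_left_cancel₀ hm this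
      have a1 := abs_le.1 n1.close
      have a2 := abs_le.1 n2.close
      rw [hx] at a1
      linarith
    · intro v hv v' hv' hne
      obtain ⟨n1, i1⟩ := hT v hv
      obtain ⟨n2, i2⟩ := hT v' hv'
      have := (separation_of_incident n1.prim n2.prim hw n1.pos n2.pos n1.le n2.le hne i1 i2).2
      rw [hθdef, ← h0]
      simpa using this
  · have hu' : (0 : ℝ) < w.1 := by exact_mod_cast hpos
    have hf : 2 < |χ (w.2.1 / w.1) - z| := hfar.resolve_left hpos.ne'
    have hb := card_le_of_separated T (fun v => (v.2.1 : ℝ) / v.1) (δ := w.1 / (Q : ℝ) ^ 2)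
      (X := 2 * (1 + K ^ 2) * ρ * w.1 / θ) (by positivity) (by positivity) ?_ ?_
    · refine hb.trans (le_of_eq ?_)
      field_simp
    · have key : ∀ v ∈ T, ∀ v' ∈ T,
          (((χ (w.2.1 / w.1) ≤ (v.2.1 : ℝ) / v.1 ∧ (v.2.1 : ℝ) / v.1 ≤ v'.2.1 / v'.1)) ∨
          ((v'.2.1 : ℝ) / v'.1 ≤ v.2.1 / v.1 ∧ (v.2.1 : ℝ) / v.1 ≤ χ (w.2.1 / w.1))) →
          |(v'.2.1 : ℝ) / v'.1 - v.2.1 / v.1| ≤ 2 * (1 + K ^ 2) * ρ * w.1 / θ := by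
        intro v hv v' hv' hside
        obtain ⟨n1, i1⟩ := hT v hv
        obtain ⟨n2, i2⟩ := hT v' hv'
        have d1 := n1.defect (g := g) i1 hpos
        have d2 := n2.defect (g := g) i2 hpos
        have h1 := h.mul_abs_sub_le d1 d2 hside
        have h2 := h.slope_le_of_isTransversal hf n1.window
        rw [le_div_iff₀ hθ0, hθdef, abs_sub_mul_eq hu']
        calc |(v'.2.1 : ℝ) / v'.1 - v.2.1 / v.1| * (w.1 * |(w.2.1 : ℝ) / w.1 - φ z|)
            ≤ |(v'.2.1 : ℝ) / v'.1 - v.2.1 / v.1| * (w.1 * ((1 + K ^ 2) *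
                |(w.2.1 : ℝ) / w.1 - φ (v.2.1 / v.1)|)) := by gcongr
          _ = (1 + K ^ 2) * w.1 * (|(w.2.1 : ℝ) / w.1 - φ (v.2.1 / v.1)| *
                |(v'.2.1 : ℝ) / v'.1 - v.2.1 / v.1|) := by ring
          _ ≤ (1 + K ^ 2) * w.1 * (2 * ρ) := by gcongr
          _ = _ := by ring
      intro v hv v' hv'
      have w1 := abs_le.1 (hT v hv).1.window
      have w2 := abs_le.1 (hT v' hv').1.window
      rcases le_total ((v.2.1 : ℝ) / v.1) (v'.2.1 / v'.1) with hle | hle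
      · exact le_trans (by linarith)
          (by positivity : (0 : ℝ) ≤ 2 * (1 + K ^ 2) * ρ * w.1 / θ)
      · rcases lt_abs.1 hf with hc | hc
        · have := key v hv v' hv' (Or.inr ⟨hle, by linarith⟩)
          rw [abs_sub_comm] at this
          exact (le_abs_self _).trans this
        · exact (le_abs_self _).trans (key v' hv' v hv (Or.inl ⟨by linarith, hle⟩))
    · intro v hv v' hv' hne
      obtain ⟨n1, i1⟩ := hT v hv
      obtain ⟨n2, i2⟩ := hT v' hv'
      have := (separation_of_incident n1.prim n2.prim hw n1.pos n2.pos n1.le n2.le hne i1 i2).1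
      rwa [abs_of_pos hu'] at this

lemma DualPair.transversal_constraints (h : DualPair K f g φ χ) {Q : ℕ} {ρ z L : ℝ} (hρ : 0 < ρ)
    (hL0 : 0 ≤ L) (hKL : K * L ^ 2 ≤ ρ) (hρ1 : ρ ≤ 1) {S : Finset (ℤ × ℤ × ℤ)}
    (hS : ∀ v ∈ S, Near f Q ρ z v) {w : ℤ × ℤ × ℤ} (hw : IsJoining S L w)
    (hfar : IsTransversal χ z w) :
    (w.1 : ℝ) ≤ L * Q ^ 2 ∧ |w.2.1 - w.1 * φ z| ≤ 3 * (1 + K ^ 2) * (ρ * Q ^ 2) ∧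
    |(w.2.2 : ℝ) - (w.2.1 * z - w.1 * f z)| ≤ (1 + 2 * K ^ 2) * |w.2.1 - w.1 * φ z| ∧
    1 ≤ K * |w.2.1 - w.1 * φ z| := by
  obtain ⟨v, hv, v', hv', hne, hi, hi', hL⟩ := hw.exists_pair
  have n1 := hS v hv
  have n2 := hS v' hv'
  have hQ : (0 : ℝ) < Q := n1.pos_Q
  have hK := h.pos
  have hK1 := h.one_le
  have hq : (0 : ℝ) < v.1 := by exact_mod_cast n1.pos
  obtain ⟨t1, t2⟩ := h.le_of_isTransversal hw.prim hw.nonneg hfar n1.pos hi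
  have hun : (0 : ℝ) ≤ w.1 := by exact_mod_cast hw.nonneg
  set θ : ℝ := |w.2.1 - w.1 * φ z| with hθdef
  have c12 : (w.1 : ℝ) ≤ L * Q ^ 2 ∧ θ ≤ 3 * (1 + K ^ 2) * (ρ * Q ^ 2) := by
    rcases hw.nonneg.eq_or_lt with h0 | hpos
    · refine ⟨by rw [← h0]; simp; positivity, ?_⟩
      have hs := (separation_of_incident n1.prim n2.prim hw.prim n1.pos n2.pos n1.le n2.le hne
        hi hi').2
      have hb := h.card_transversal_line_le hρ hw.prim hw.nonneg hfar {v, v'} (by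
        intro x hx
        simp only [Finset.mem_insert, Finset.mem_singleton] at hx
        rcases hx with rfl | rfl
        · exact ⟨n1, hi⟩
        · exact ⟨n2, hi'⟩)
      rw [Finset.card_pair hne, ← hθdef] at hb
      have hθ0 : 0 < θ := by
        by_contra hneg
        nlinarith [abs_nonneg ((w.2.1 : ℝ) - w.1 * φ z)]
      have hb' : 1 ≤ 2 * (1 + K ^ 2) * (ρ * Q ^ 2) / θ := by push_cast at hb; linarith
      rw [le_div_iff₀ hθ0] at hb'
      have : 0 ≤ (1 + K ^ 2) * (ρ * Q ^ 2) := by positivity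
      linarith
    · have hu' : (0 : ℝ) < w.1 := by exact_mod_cast hpos
      have hf : 2 < |χ (w.2.1 / w.1) - z| := hfar.resolve_left hpos.ne'
      obtain ⟨a1, a2, -⟩ := h.line_constraints hρ hw.prim hpos n1 n2 hne hi hi' hL hKL
      refine ⟨a1, ?_⟩
      have h2 := h.slope_le_of_isTransversal hf n1.window
      rw [hθdef, abs_sub_mul_eq hu']
      calc w.1 * |(w.2.1 : ℝ) / w.1 - φ z|
          ≤ w.1 * ((1 + K ^ 2) * |(w.2.1 : ℝ) / w.1 - φ (v.2.1 / v.1)|) := by gcongr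
        _ = (1 + K ^ 2) * (w.1 * |(w.2.1 : ℝ) / w.1 - φ (v.2.1 / v.1)|) := by ring
        _ ≤ (1 + K ^ 2) * (3 * (ρ * Q ^ 2)) := by gcongr
        _ = _ := by ring
  refine ⟨c12.1, c12.2, ?_, t2⟩
  set x : ℝ := v.2.1 / v.1 with hx
  set y : ℝ := v.2.2 / v.1 with hy
  have hn : (w.2.2 : ℝ) = w.2.1 * x - w.1 * y := by
    have hi2 : (w.1 : ℝ) * v.2.2 + v.1 * w.2.2 = v.2.1 * w.2.1 := by exact_mod_cast hi
    rw [hx, hy]; field_simp; linarith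
  have hwin : |x - z| ≤ 1 := n1.window
  have hcl : |y - f x| ≤ ρ := n1.close
  have hsub := h.sub_eq z x
  have hup := h.upper' x (φ z)
  rw [h.left_inv] at hup
  have hlo := h.defect_nonneg x (φ z)
  set D : ℝ := f x + g (φ z) - x * φ z with hD
  have hsq : (x - z) ^ 2 ≤ 1 := by rw [← sq_abs]; exact pow_le_one₀ (abs_nonneg _) hwin
  have hDK : |D| ≤ K := by rw [abs_of_nonneg hlo]; nlinarith
  have e : (w.2.2 : ℝ) - (w.2.1 * z - w.1 * f z) =
      (w.2.1 - w.1 * φ z) * (x - z) - w.1 * D - w.1 * (y - f x) := by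
    rw [hn]; linear_combination (-(w.1 : ℝ)) * hsub
  rw [e]
  calc |(w.2.1 - w.1 * φ z) * (x - z) - w.1 * D - w.1 * (y - f x)|
      ≤ |(w.2.1 - w.1 * φ z) * (x - z)| + |w.1 * D| + |w.1 * (y - f x)| :=
        (abs_sub _ _).trans (by gcongr; exact abs_sub _ _)
    _ = θ * |x - z| + w.1 * |D| + w.1 * |y - f x| := by
        rw [abs_mul, abs_mul, abs_mul, abs_of_nonneg hun]
    _ ≤ θ * 1 + (K * θ) * K + (K * θ) * 1 := by gcongr; exact hcl.trans hρ1
    _ ≤ (1 + 2 * K ^ 2) * θ := by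
        have : 0 ≤ θ := abs_nonneg _
        nlinarith [mul_nonneg (mul_nonneg hK.le (by linarith : 0 ≤ K - 1)) this]

lemma card_le_mul_card_image_real {α β : Type*} [DecidableEq β] (S : Finset α) (p : α → β) {B : ℝ}
    (hB : ∀ b ∈ S.image p, ((S.filter (fun x => p x = b)).card : ℝ) ≤ B) :
    (S.card : ℝ) ≤ B * (S.image p).card := by
  rw [Finset.card_eq_sum_card_image p S]
  push_cast
  calc ∑ b ∈ S.image p, ((S.filter (fun x => p x = b)).card : ℝ)
      ≤ ∑ _b ∈ S.image p, B := Finset.sum_le_sum hB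
    _ = B * (S.image p).card := by rw [Finset.sum_const, nsmul_eq_mul, mul_comm]

/-- The total contribution of transversal lines. -/
lemma DualPair.sum_transversal_le (h : DualPair K f g φ χ) {Q : ℕ} {ρ z L t : ℝ} (hρ : 0 < ρ)
    (ht : t = ρ * Q ^ 2) (ht1 : 1 ≤ t) (htQ : t ≤ Q) (hL0 : 0 ≤ L) (hKL : K * L ^ 2 ≤ ρ)
    (hLQ : L * Q ^ 2 ≤ Q / t) {S : Finset (ℤ × ℤ × ℤ)} (hS : ∀ v ∈ S, Near f Q ρ z v)
    (W : Finset (ℤ × ℤ × ℤ)) (hW : ∀ w ∈ W, IsJoining S L w ∧ IsTransversal χ z w)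
    (c : ℤ × ℤ × ℤ → Finset (ℤ × ℤ × ℤ)) (hc : ∀ w, ∀ v ∈ c w, v ∈ S ∧ Incident v w) :
    ∑ w ∈ W, ((c w).card : ℝ) ≤ 525 * (1 + K ^ 2) ^ 3 * (t * Q) := by
  classical
  have hK := h.pos
  have hK1 := h.one_le
  have hQ1 : (1 : ℝ) ≤ Q := ht1.trans htQ
  have ht0 : 0 < t := by linarith
  set E : ℝ := 1 + K ^ 2 with hE
  have hE0 : 1 ≤ E := by rw [hE]; nlinarith
  have hKE : K ≤ E := by rw [hE]; nlinarith
  have hρ1 : ρ ≤ 1 := by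
    have h1 : (Q : ℝ) * (ρ * Q) ≤ Q * 1 := by
      calc (Q : ℝ) * (ρ * Q) = t := by rw [ht]; ring
        _ ≤ Q * 1 := by linarith
    have h2 := le_of_mul_le_mul_left h1 (by linarith)
    nlinarith
  set θ : ℤ × ℤ → ℝ := fun p => |p.2 - p.1 * φ z| with hθ
  set pr : ℤ × ℤ × ℤ → ℤ × ℤ := fun w => (w.1, w.2.1) with hpr
  have hcon := fun w hw => h.transversal_constraints hρ hL0 hKL hρ1 hS (hW w hw).1 (hW w hw).2
  have hline : ∀ w ∈ W, ((c w).card : ℝ) ≤ 5 * E * t / θ (pr w) := by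
    intro w hw
    obtain ⟨-, c2, -, c4⟩ := hcon w hw
    have hθ0 : 0 < θ (pr w) := by
      by_contra hneg
      have : θ (pr w) ≤ 0 := not_lt.1 hneg
      simp only [hθ, hpr] at this
      nlinarith
    refine (h.card_transversal_line_le hρ (hW w hw).1.prim (hW w hw).1.nonneg (hW w hw).2 (c w)
      (fun v hv => ⟨hS v (hc w v hv).1, (hc w v hv).2⟩)).trans ?_
    rw [← ht] at c2 ⊢
    have : 1 ≤ 3 * E * t / θ (pr w) := by rwa [le_div_iff₀ hθ0, one_mul]
    calc 1 + 2 * E * t / θ (pr w) ≤ 3 * E * t / θ (pr w) + 2 * E * t / θ (pr w) := by gcongr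
      _ = _ := by ring
  have hfib : ∀ p ∈ W.image pr,
      ∑ w ∈ W.filter (fun w => pr w = p), 5 * E * t / θ (pr w) ≤ 25 * E ^ 2 * t := by
    intro p hp
    obtain ⟨w₀, hw₀, rfl⟩ := Finset.mem_image.1 hp
    obtain ⟨-, -, -, c4⟩ := hcon w₀ hw₀
    have c4' : 1 ≤ K * θ (pr w₀) := c4
    have hθ0 : 0 < θ (pr w₀) := by
      by_contra hneg
      nlinarith
    have hcard : ((W.filter (fun w => pr w = pr w₀)).card : ℝ) ≤ 5 * E * θ (pr w₀) := by
      have := card_int_le (W.filter (fun w => pr w = pr w₀)) (fun w => w.2.2)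
        (c := w₀.2.1 * z - w₀.1 * f z) (r := (1 + 2 * K ^ 2) * θ (pr w₀)) ?_ (by positivity) ?_
      · refine this.trans ?_
        have : K * θ (pr w₀) ≤ E * θ (pr w₀) := by gcongr
        have e : (1 + 2 * K ^ 2) * θ (pr w₀) ≤ 2 * E * θ (pr w₀) := by
          gcongr; rw [hE]; linarith
        linarith
      · intro w hw w' hw' heq
        simp only [Finset.coe_filter, Set.mem_ofPred_eq] at hw hw'
        have e := hw.2.trans hw'.2.symm
        simp only [hpr, Prod.mk.injEq] at e
        exact Prod.ext e.1 (Prod.ext e.2 heq)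
      · intro w hw
        rw [Finset.mem_filter] at hw
        obtain ⟨-, -, c3, -⟩ := hcon w hw.1
        have e := hw.2
        simp only [hpr, Prod.mk.injEq] at e
        simpa only [hθ, hpr, e.1, e.2] using c3
    calc ∑ w ∈ W.filter (fun w => pr w = pr w₀), 5 * E * t / θ (pr w)
        = ∑ w ∈ W.filter (fun w => pr w = pr w₀), 5 * E * t / θ (pr w₀) := by
          refine Finset.sum_congr rfl (fun w hw => ?_)
          rw [(Finset.mem_filter.1 hw).2]
      _ = (W.filter (fun w => pr w = pr w₀)).card * (5 * E * t / θ (pr w₀)) := by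
          rw [Finset.sum_const, nsmul_eq_mul]
      _ ≤ (5 * E * θ (pr w₀)) * (5 * E * t / θ (pr w₀)) := by gcongr
      _ = 25 * E ^ 2 * t := by field_simp; ring
  have hpairs : ((W.image pr).card : ℝ) ≤ (7 * E * t) * (3 * (Q / t)) := by
    have h1 := card_le_mul_card_image_real (W.image pr) Prod.fst (B := 7 * E * t) ?_
    · refine h1.trans ?_
      gcongr
      have := card_int_le ((W.image pr).image Prod.fst) id (Set.injOn_id _) (c := 0) (r := Q / t)
        (by positivity) ?_
      · refine this.trans ?_
        have : 1 ≤ Q / t := by rwa [le_div_iff₀ ht0, one_mul]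
        linarith
      · intro u hu
        simp only [Finset.mem_image] at hu
        obtain ⟨p, ⟨w, hw, rfl⟩, rfl⟩ := hu
        obtain ⟨c1, -⟩ := hcon w hw
        have : (0 : ℝ) ≤ w.1 := by exact_mod_cast (hW w hw).1.nonneg
        simp only [hpr, id, sub_zero]
        rw [abs_of_nonneg this]
        exact c1.trans hLQ
    · intro u _
      have := card_int_le ((W.image pr).filter (fun p => p.1 = u)) Prod.snd
        (c := u * φ z) (r := 3 * E * t) ?_ (by positivity) ?_
      · refine this.trans ?_
        nlinarith
      · intro p hp p' hp' heq
        simp only [Finset.coe_filter, Set.mem_ofPred_eq] at hp hp'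
        exact Prod.ext (hp.2.trans hp'.2.symm) heq
      · intro p hp
        rw [Finset.mem_filter] at hp
        obtain ⟨hp, rfl⟩ := hp
        obtain ⟨w, hw, rfl⟩ := Finset.mem_image.1 hp
        obtain ⟨-, c2, -⟩ := hcon w hw
        rw [← ht] at c2
        exact c2
  calc ∑ w ∈ W, ((c w).card : ℝ) ≤ ∑ w ∈ W, 5 * E * t / θ (pr w) := Finset.sum_le_sum hline
    _ = ∑ p ∈ W.image pr, ∑ w ∈ W.filter (fun w => pr w = p), 5 * E * t / θ (pr w) :=
        (Finset.sum_fiberwise_of_maps_to (fun w hw => Finset.mem_image_of_mem pr hw) _).symm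
    _ ≤ ∑ _p ∈ W.image pr, 25 * E ^ 2 * t := Finset.sum_le_sum hfib
    _ = (W.image pr).card * (25 * E ^ 2 * t) := by rw [Finset.sum_const, nsmul_eq_mul]
    _ ≤ ((7 * E * t) * (3 * (Q / t))) * (25 * E ^ 2 * t) := by gcongr
    _ = _ := by field_simp; ring

/-- The trivial bound for the number of rational points near the curve. -/
lemma card_near_le_trivial {Q : ℕ} {ρ z t : ℝ} (ht : t = ρ * Q ^ 2) (htQ : Q ≤ t)
    (hQ : 0 < Q) (S : Finset (ℤ × ℤ × ℤ)) (hS : ∀ v ∈ S, Near f Q ρ z v) :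
    (S.card : ℝ) ≤ 27 * (t * Q) := by
  classical
  have hQ1 : (1 : ℝ) ≤ Q := by exact_mod_cast hQ
  have hρQ : 1 ≤ ρ * Q := by
    have : (Q : ℝ) * 1 ≤ Q * (ρ * Q) := by rw [mul_one]; linarith
    exact le_of_mul_le_mul_left this (by linarith)
  have h1 := card_le_mul_card_image_real S (fun v => (v.1, v.2.1)) (B := 3 * (ρ * Q)) ?_
  · have h2 := card_le_mul_card_image_real (S.image (fun v => (v.1, v.2.1))) Prod.fst
      (B := 3 * Q) ?_
    · have h3 := card_int_le ((S.image (fun v => (v.1, v.2.1))).image Prod.fst) id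
        (Set.injOn_id _) (c := 0) (r := Q) (by linarith) ?_
      · calc (S.card : ℝ) ≤ _ := h1
          _ ≤ 3 * (ρ * Q) * (3 * Q * (2 * Q + 1)) := by
            gcongr
            exact h2.trans (by gcongr)
          _ ≤ 3 * (ρ * Q) * (3 * Q * (3 * Q)) := by gcongr; linarith
          _ = _ := by rw [ht]; ring
      · intro u hu
        simp only [Finset.mem_image] at hu
        obtain ⟨p, ⟨v, hv, rfl⟩, rfl⟩ := hu
        have : (0 : ℝ) ≤ v.1 := by exact_mod_cast (hS v hv).pos.le
        simp only [id, sub_zero]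
        rw [abs_of_nonneg this]
        exact (hS v hv).le
    · intro q _
      have := card_int_le ((S.image (fun v => (v.1, v.2.1))).filter (fun p => p.1 = q)) Prod.snd
        (c := q * z) (r := Q) ?_ (by linarith) ?_
      · linarith
      · intro p hp p' hp' heq
        simp only [Finset.coe_filter, Set.mem_ofPred_eq] at hp hp'
        exact Prod.ext (hp.2.trans hp'.2.symm) heq
      · intro p hp
        rw [Finset.mem_filter] at hp
        obtain ⟨hp, rfl⟩ := hp
        obtain ⟨v, hv, rfl⟩ := Finset.mem_image.1 hp
        have n := hS v hv
        have hq : (0 : ℝ) < v.1 := by exact_mod_cast n.pos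
        rw [abs_sub_mul_eq hq]
        calc (v.1 : ℝ) * |(v.2.1 : ℝ) / v.1 - z| ≤ Q * 1 :=
              mul_le_mul n.le n.window (abs_nonneg _) (by linarith)
          _ = Q := mul_one _
  · intro p hp
    obtain ⟨v₀, hv₀, rfl⟩ := Finset.mem_image.1 hp
    have := card_int_le (S.filter (fun v => (v.1, v.2.1) = (v₀.1, v₀.2.1))) (fun v => v.2.2)
        (c := v₀.1 * f (v₀.2.1 / v₀.1)) (r := ρ * Q) ?_ (by linarith) ?_
    · linarith
    · intro v hv v' hv' heq
      simp only [Finset.coe_filter, Set.mem_ofPred_eq] at hv hv'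
      have e := hv.2.trans hv'.2.symm
      simp only [Prod.mk.injEq] at e
      exact Prod.ext e.1 (Prod.ext e.2 heq)
    · intro v hv
      rw [Finset.mem_filter] at hv
      obtain ⟨hv, e⟩ := hv
      simp only [Prod.mk.injEq] at e
      rw [← e.1, ← e.2]
      have n := hS v hv
      have hq : (0 : ℝ) < v.1 := by exact_mod_cast n.pos
      rw [abs_sub_mul_eq hq, mul_comm ρ]
      exact mul_le_mul n.le n.close (abs_nonneg _) (by linarith)

lemma sum_geometric_le (J : Finset ℕ) {r a M : ℝ} (hr : 1 < r) (ha : 0 < a) (hM : 0 ≤ M)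
    (h : ∀ j ∈ J, r ^ j * a ≤ M) : ∑ j ∈ J, r ^ j * a ≤ M * (r / (r - 1)) := by
  have := sum_pow_le_of_pow_le J hr (M := M / a) (by positivity)
    (fun j hj => (le_div_iff₀ ha).2 (h j hj))
  rw [← Finset.sum_mul]
  calc (∑ j ∈ J, r ^ j) * a ≤ M / a * (r / (r - 1)) * a := by gcongr
    _ = _ := by field_simp

lemma sum_inv_two_pow_le (J : Finset ℕ) : ∑ j ∈ J, ((2 : ℝ) ^ (j + 1))⁻¹ ≤ 1 := by
  have h : HasSum (fun n : ℕ => (1 : ℝ) / 2 / 2 ^ n) 1 := hasSum_geometric_two' 1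
  refine (le_of_eq (Finset.sum_congr rfl fun j _ => ?_)).trans
    (sum_le_hasSum J (fun i _ => by positivity) h)
  rw [pow_succ]; field_simp

/-- Tangential lines of a given size correspond to rational points near the dual curve. -/
lemma DualPair.card_tangential_le (h : DualPair K f g φ χ) {H : ℕ} {ρ z N : ℝ}
    (hN0 : 0 ≤ N)
    (hN : ∀ z' (S : Finset (ℤ × ℤ × ℤ)), (∀ v ∈ S, Near g H ρ z' v) → (S.card : ℝ) ≤ N)
    (V : Finset (ℤ × ℤ × ℤ))
    (hV : ∀ w ∈ V, IsPrimitive w ∧ 0 < w.1 ∧ (w.1 : ℝ) ≤ H ∧ |χ (w.2.1 / w.1) - z| ≤ 2 ∧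
      |g (w.2.1 / w.1) - w.2.2 / w.1| ≤ ρ) :
    (V.card : ℝ) ≤ N * (2 * K + 3) := by
  classical
  have hK := h.pos
  set k : ℤ × ℤ × ℤ → ℤ := fun w => round (((w.2.1 : ℝ) / w.1 - φ z) / 2) with hk
  have hround : ∀ w, |((w.2.1 : ℝ) / w.1 - φ z) / 2 - k w| ≤ 1 / 2 := fun w => abs_sub_round _
  have h1 := card_le_mul_card_image_real V k (B := N) ?_
  · have h2 := card_int_le (V.image k) id (Set.injOn_id _) (c := 0) (r := K + 1) (by linarith) ?_
    · exact h1.trans (by gcongr; linarith)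
    · intro a ha
      obtain ⟨w, hw, rfl⟩ := Finset.mem_image.1 ha
      have e1 := h.lip (χ (w.2.1 / w.1)) z
      rw [h.right_inv] at e1
      have e2 := (hV w hw).2.2.2.1
      have e3 : |(w.2.1 : ℝ) / w.1 - φ z| ≤ K * 2 := e1.trans (by gcongr)
      have e4 := abs_le.1 e3
      have e5 := abs_le.1 (hround w)
      simp only [id, sub_zero]
      rw [abs_le]
      constructor <;> linarith
  · intro a _
    refine hN (φ z + 2 * a) _ (fun w hwa => ?_)
    obtain ⟨hw, rfl⟩ := Finset.mem_filter.1 hwa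
    obtain ⟨p1, p2, p3, -, p5⟩ := hV w hw
    refine ⟨p1, p2, p3, ?_, by rwa [abs_sub_comm]⟩
    have e5 := abs_le.1 (hround w)
    rw [abs_le]
    constructor <;> linarith

/-- The size of the counting bound at the critical scale. -/
lemma critical_bound_le {A x H ε ρ : ℝ} (hA : 0 ≤ A) (hx : 0 ≤ x) (hH : 1 ≤ H) (hε : 0 ≤ ε)
    (hρ : ρ * H ^ 2 = max (x ^ 2) 1) :
    A * (ρ * H ^ 2 * H + (ρ * H ^ 2) ^ (3 / 4 : ℝ) * H ^ (1 + ε)) ≤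
      A * (x ^ 2 * H + x * √x * H ^ (1 + ε) + 2 * H ^ (1 + ε)) := by
  rw [hρ]
  have hH0 : 0 < H := by linarith
  have e0 : H ≤ H ^ (1 + ε) := by
    conv_lhs => rw [← Real.rpow_one H]
    exact Real.rpow_le_rpow_of_exponent_le hH (by linarith)
  have e1 : (x ^ 2) ^ (3 / 4 : ℝ) = x * √x := by
    rw [Real.sqrt_eq_rpow, ← Real.rpow_natCast, ← Real.rpow_mul hx,
      ← Real.rpow_one_add' hx (by norm_num)]
    norm_num
  have e2 : 0 ≤ x ^ 2 * H := by positivity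
  have e3 : 0 ≤ x * √x * H ^ (1 + ε) := by positivity
  refine mul_le_mul_of_nonneg_left ?_ hA
  rcases le_total (x ^ 2) 1 with h1 | h1
  · rw [max_eq_right h1]
    simp only [Real.one_rpow]
    linarith
  · rw [max_eq_left h1, e1]
    linarith

lemma sum_prod_le_of_fiber (P : Finset (ℕ × ℕ)) (B : ℕ × ℕ → ℝ) (C : ℕ → ℝ)
    (h : ∀ i ∈ P.image Prod.fst, ∀ J : Finset ℕ, (∀ j ∈ J, (i, j) ∈ P) → ∑ j ∈ J, B (i, j) ≤ C i) :
    ∑ p ∈ P, B p ≤ ∑ i ∈ P.image Prod.fst, C i := by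
  rw [← Finset.sum_fiberwise_of_maps_to (fun p hp => Finset.mem_image_of_mem Prod.fst hp)]
  refine Finset.sum_le_sum fun i hi => ?_
  have e : ∑ p ∈ P.filter (fun p => p.1 = i), B p =
      ∑ j ∈ (P.filter (fun p => p.1 = i)).image Prod.snd, B (i, j) := by
    rw [Finset.sum_image]
    · refine Finset.sum_congr rfl fun p hp => ?_
      rw [← (Finset.mem_filter.1 hp).2]
    · intro p hp p' hp' heq
      simp only [Finset.coe_filter, Set.mem_ofPred_eq] at hp hp'
      exact Prod.ext (hp.2.trans hp'.2.symm) heq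
  rw [e]
  refine h i hi _ fun j hj => ?_
  obtain ⟨p, hp, rfl⟩ := Finset.mem_image.1 hj
  obtain ⟨hp', rfl⟩ := Finset.mem_filter.1 hp
  exact hp'

/-- Geometric summation over the dyadic offsets. -/
lemma sum_offset_le {K t ρ Q H G : ℝ} (hK : 1 ≤ K) (hρ : 0 < ρ) (hQ : 0 < Q) (ht : t = ρ * Q ^ 2)
    (hH : 0 < H) (hG : 0 ≤ G)
    (J : Finset ℕ) (hJ : ∀ j ∈ J, 2 ^ (j + 1) * √ρ * H ≤ 16 * K * t) :
    ∑ j ∈ J, (2 ^ (j + 1) * √ρ * H * H + √(2 ^ (j + 1) * √ρ * H) * (H * G) +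
      2 * (H * G) / (2 ^ (j + 1) * √ρ * H)) ≤
      32 * K * (t * H + √t * (H * G) + Q / √t * G) := by
  have ht0 : 0 < t := by rw [ht]; positivity
  have hsρ : 0 < √ρ := Real.sqrt_pos.2 hρ
  have hst : √t = √ρ * Q := by
    rw [ht, Real.sqrt_mul hρ.le, Real.sqrt_sq hQ.le]
  have hst0 : 0 < √t := Real.sqrt_pos.2 ht0
  have b1 : ∑ j ∈ J, 2 ^ (j + 1) * √ρ * H ≤ 32 * K * t := by
    have := sum_geometric_le J (r := 2) (a := 2 * √ρ * H) (M := 16 * K * t) (by norm_num)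
      (by positivity) (by positivity) (fun j hj => by
        refine le_trans (le_of_eq ?_) (hJ j hj); ring)
    calc ∑ j ∈ J, 2 ^ (j + 1) * √ρ * H = ∑ j ∈ J, 2 ^ j * (2 * √ρ * H) :=
          Finset.sum_congr rfl fun j _ => by ring
      _ ≤ _ := this
      _ = _ := by ring
  have b2 : ∑ j ∈ J, √(2 ^ (j + 1) * √ρ * H) ≤ 16 * K * √t := by
    have e : ∀ j : ℕ, √(2 ^ (j + 1) * √ρ * H) = √2 ^ j * √(2 * √ρ * H) := fun j => by
      have e' : (2 : ℝ) ^ (j + 1) * √ρ * H = (√2 ^ j) ^ 2 * (2 * √ρ * H) := by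
        rw [← pow_mul, mul_comm j, pow_mul, Real.sq_sqrt (by norm_num)]; ring
      rw [e', Real.sqrt_mul (by positivity), Real.sqrt_sq (by positivity)]
    have hs2 : (1.4 : ℝ) ≤ √2 := Real.le_sqrt_of_sq_le (by norm_num)
    have := sum_geometric_le J (r := √2) (a := √(2 * √ρ * H)) (M := √(16 * K * t))
      (by linarith) (by positivity) (by positivity) (fun j hj => by
        rw [← e]; exact Real.sqrt_le_sqrt (hJ j hj))
    simp only [e]
    refine this.trans ?_
    have e1 : √(16 * K * t) ≤ 4 * K * √t := by
      rw [Real.sqrt_le_left (by positivity), mul_pow, Real.sq_sqrt ht0.le]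
      nlinarith [mul_pos (by linarith : 0 < K) ht0]
    have e2 : √2 / (√2 - 1) ≤ 4 := by
      rw [div_le_iff₀ (by linarith)]; linarith
    have e3 : 0 ≤ √2 / (√2 - 1) := div_nonneg (by positivity) (by linarith)
    calc √(16 * K * t) * (√2 / (√2 - 1)) ≤ 4 * K * √t * 4 := by gcongr
      _ = _ := by ring
  have b3 : ∑ j ∈ J, 2 * (H * G) / (2 ^ (j + 1) * √ρ * H) ≤ 2 * (Q / √t * G) := by
    calc ∑ j ∈ J, 2 * (H * G) / (2 ^ (j + 1) * √ρ * H)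
        = (∑ j ∈ J, ((2 : ℝ) ^ (j + 1))⁻¹) * (2 * G / √ρ) := by
          rw [Finset.sum_mul]
          refine Finset.sum_congr rfl fun j _ => ?_
          field_simp
      _ ≤ 1 * (2 * G / √ρ) := by gcongr; exact sum_inv_two_pow_le J
      _ = _ := by rw [hst]; field_simp
  have b1' := mul_le_mul_of_nonneg_right b1 hH.le
  have b2' := mul_le_mul_of_nonneg_right b2 (by positivity : 0 ≤ H * G)
  rw [Finset.sum_mul] at b1' b2'
  rw [Finset.sum_add_distrib, Finset.sum_add_distrib]
  calc _ ≤ 32 * K * t * H + 16 * K * √t * (H * G) + 2 * (Q / √t * G) :=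
        add_le_add (add_le_add b1' b2') b3
    _ ≤ _ := by
      have f1 : 0 ≤ K * √t * (H * G) := by positivity
      have f2 : Q / √t * G ≤ K * (Q / √t * G) := le_mul_of_one_le_left (by positivity) hK
      have f3 : 0 ≤ K * (Q / √t * G) := by positivity
      linarith

/-- Geometric summation over the dyadic heights. -/
lemma sum_height_le {t Q Y ε : ℝ} (hY : 0 < Y) (ht : 0 < t) (hQ : 0 < Q) (hε : 0 < ε)
    (I : Finset ℕ) (hI : ∀ i ∈ I, (2 : ℝ) ^ (i + 1) ≤ Y) :
    ∑ i ∈ I, (t * 2 ^ (i + 1) + √t * (2 ^ (i + 1) * ((2 : ℝ) ^ (i + 1)) ^ ε) +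
      Q / √t * ((2 : ℝ) ^ (i + 1)) ^ ε) ≤
      2 * t * Y + 2 * √t * (Y * Y ^ ε) + (2 ^ ε / (2 ^ ε - 1)) * (Q / √t * Y ^ ε) := by
  have b1 : ∑ i ∈ I, (2 : ℝ) ^ (i + 1) ≤ 2 * Y := by
    have := sum_geometric_le I (r := 2) (a := 2) (M := Y) (by norm_num)
      (by positivity) hY.le (fun j hj => by rw [← pow_succ]; exact hI j hj)
    simp only [pow_succ]
    refine this.trans (by linarith)
  have b2 : ∑ i ∈ I, (2 : ℝ) ^ (i + 1) * ((2 : ℝ) ^ (i + 1)) ^ ε ≤ 2 * (Y * Y ^ ε) := by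
    calc ∑ i ∈ I, (2 : ℝ) ^ (i + 1) * ((2 : ℝ) ^ (i + 1)) ^ ε
        ≤ ∑ i ∈ I, (2 : ℝ) ^ (i + 1) * Y ^ ε := by
          refine Finset.sum_le_sum fun i hi => ?_
          have := hI i hi
          gcongr
      _ ≤ 2 * Y * Y ^ ε := by rw [← Finset.sum_mul]; gcongr
      _ = _ := by ring
  have hr : (1 : ℝ) < 2 ^ ε := Real.one_lt_rpow (by norm_num) hε
  have b3 : ∑ i ∈ I, ((2 : ℝ) ^ (i + 1)) ^ ε ≤ Y ^ ε * (2 ^ ε / (2 ^ ε - 1)) := by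
    have e : ∀ i : ℕ, ((2 : ℝ) ^ (i + 1)) ^ ε = (2 ^ ε) ^ i * 2 ^ ε := fun i => by
      rw [← pow_succ, ← Real.rpow_natCast, ← Real.rpow_natCast, ← Real.rpow_mul (by norm_num),
        ← Real.rpow_mul (by norm_num), mul_comm]
    simp only [e]
    refine sum_geometric_le I hr (by positivity) (by positivity) fun i hi => ?_
    rw [← e]
    exact Real.rpow_le_rpow (by positivity) (hI i hi) hε.le
  rw [Finset.sum_add_distrib, Finset.sum_add_distrib, ← Finset.mul_sum, ← Finset.mul_sum,
    ← Finset.mul_sum]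
  have hst0 : 0 < √t := Real.sqrt_pos.2 ht
  calc _ ≤ t * (2 * Y) + √t * (2 * (Y * Y ^ ε)) + Q / √t * (Y ^ ε * (2 ^ ε / (2 ^ ε - 1))) := by
        gcongr
    _ = _ := by ring

/-- Dyadic size data of a tangential line. -/
lemma DualPair.exists_dyadic (h : DualPair K f g φ χ) {Q : ℕ} {ρ z L t Y : ℝ} (hρ : 0 < ρ)
    (ht : t = ρ * Q ^ 2) (hKL : K * L ^ 2 ≤ ρ) (hLQ : 2 * (L * Q ^ 2) ≤ Y)
    {S : Finset (ℤ × ℤ × ℤ)} (hS : ∀ v ∈ S, Near f Q ρ z v) {w : ℤ × ℤ × ℤ}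
    (hw : IsJoining S L w) (hw' : ¬ IsTransversal χ z w) (T : Finset (ℤ × ℤ × ℤ))
    (hT : ∀ v ∈ T, v ∈ S ∧ Incident v w) :
    ∃ p : ℕ × ℕ, (2 : ℝ) ^ (p.1 + 1) ≤ Y ∧
      2 ^ (p.2 + 1) * √ρ * 2 ^ (p.1 + 1) ≤ 16 * K * t ∧
      (T.card : ℝ) ≤ 56 * K * t / (2 ^ (p.2 + 1) * √ρ * 2 ^ (p.1 + 1)) ∧
      0 < w.1 ∧ (w.1 : ℝ) ≤ 2 ^ (p.1 + 1) ∧ |χ (w.2.1 / w.1) - z| ≤ 2 ∧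
      |g (w.2.1 / w.1) - w.2.2 / w.1| ≤ (2 ^ (p.2 + 1) * √ρ) ^ 2 := by
  have hK := h.pos
  rw [IsTransversal, not_or, not_lt] at hw'
  obtain ⟨v, hv, v', hv', hne, hi, hi', hL⟩ := hw.exists_pair
  have hu : 0 < w.1 := lt_of_le_of_ne hw.nonneg (Ne.symm hw'.1)
  have hu' : (1 : ℝ) ≤ w.1 := by exact_mod_cast hu
  obtain ⟨c1, -, c3⟩ := h.line_constraints hρ hw.prim hu (hS v hv) (hS v' hv') hne hi hi' hL hKL
  have hQ := (hS v hv).pos_Q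
  have ht0 : 0 < t := by rw [ht]; positivity
  set M : ℝ := max |g (w.2.1 / w.1) - w.2.2 / w.1| ρ with hM
  have hM0 : 0 < M := lt_of_lt_of_le hρ (le_max_right _ _)
  have hr : 0 < √M := Real.sqrt_pos.2 hM0
  have hsρ : 0 < √ρ := Real.sqrt_pos.2 hρ
  have hr2 : √M ^ 2 = M := Real.sq_sqrt hM0.le
  have hur : w.1 * √M ≤ 4 * K * t := by
    rw [← ht] at c3
    refine le_of_sq_le_sq ?_ (by positivity)
    rwa [mul_pow, hr2]
  obtain ⟨i, hi1, hi2⟩ := exists_nat_pow_near hu' (one_lt_two : (1 : ℝ) < 2)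
  obtain ⟨j, hj1, hj2⟩ := exists_nat_pow_near
    ((one_le_div hsρ).2 (Real.sqrt_le_sqrt (le_max_right _ _ : ρ ≤ M)))
    (one_lt_two : (1 : ℝ) < 2)
  rw [le_div_iff₀ hsρ] at hj1
  rw [div_lt_iff₀ hsρ] at hj2
  have hi3 : (2 : ℝ) ^ (i + 1) ≤ 2 * w.1 := by rw [pow_succ]; linarith
  have hj3 : (2 : ℝ) ^ (j + 1) * √ρ ≤ 2 * √M := by rw [pow_succ]; linarith
  have hx : (2 : ℝ) ^ (j + 1) * √ρ * 2 ^ (i + 1) ≤ 4 * (w.1 * √M) := by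
    calc (2 : ℝ) ^ (j + 1) * √ρ * 2 ^ (i + 1) ≤ 2 * √M * (2 * w.1) := by gcongr
      _ = _ := by ring
  refine ⟨(i, j), by linarith, by linarith, ?_, hu, hi2.le, hw'.2, ?_⟩
  · have := h.card_line_le hρ hw.prim hu hr hr2 T (fun v hv => ⟨hS v (hT v hv).1, (hT v hv).2⟩)
    rw [← ht] at this
    have hur0 : 0 < w.1 * √M := by positivity
    have e : 2 ≤ 8 * K * t / (w.1 * √M) := by rw [le_div_iff₀ hur0]; linarith
    calc (T.card : ℝ) ≤ 2 + 6 * K * t / (w.1 * √M) := this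
      _ ≤ 8 * K * t / (w.1 * √M) + 6 * K * t / (w.1 * √M) := by linarith
      _ = 56 * K * t / (4 * (w.1 * √M)) := by field_simp; ring
      _ ≤ _ := by gcongr
  · calc |g (w.2.1 / w.1) - w.2.2 / w.1| ≤ M := le_max_left _ _
      _ = √M ^ 2 := hr2.symm
      _ ≤ _ := by gcongr

/-- The total contribution of tangential lines, in terms of a counting bound for the dual curve. -/
lemma DualPair.sum_tangential_le (h : DualPair K f g φ χ) {Q : ℕ} {ρ z L t A ε c : ℝ}
    (hρ : 0 < ρ) (ht : t = ρ * Q ^ 2) (ht1 : 1 ≤ t) (htQ : t ≤ Q) (hA : 0 ≤ A) (hε : 0 < ε)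
    (hε1 : ε ≤ 1) (hc0 : 0 < c) (hc : 2 * c < 1) (hKL : K * L ^ 2 ≤ ρ)
    (hLQ : L * Q ^ 2 ≤ c * (Q / t))
    (hIH : ∀ H < Q, ∀ ρ' z' (S : Finset (ℤ × ℤ × ℤ)), 0 < ρ' → 1 ≤ ρ' * (H : ℝ) ^ 2 →
      (∀ v ∈ S, Near g H ρ' z' v) → (S.card : ℝ) ≤
        A * (ρ' * H ^ 2 * H + (ρ' * H ^ 2) ^ (3 / 4 : ℝ) * (H : ℝ) ^ (1 + ε)))
    {S : Finset (ℤ × ℤ × ℤ)} (hS : ∀ v ∈ S, Near f Q ρ z v)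
    (W : Finset (ℤ × ℤ × ℤ)) (hW : ∀ w ∈ W, IsJoining S L w ∧ ¬ IsTransversal χ z w)
    (T : ℤ × ℤ × ℤ → Finset (ℤ × ℤ × ℤ)) (hT : ∀ w, ∀ v ∈ T w, v ∈ S ∧ Incident v w) :
    ∑ w ∈ W, ((T w).card : ℝ) ≤ 8960 * K ^ 3 * (2 ^ ε / (2 ^ ε - 1) + 4) * (2 * c) ^ ε *
      (A * (t * Q + t ^ (3 / 4 : ℝ) * (Q : ℝ) ^ (1 + ε))) := by
  classical
  have hK := h.pos
  have hK1 := h.one_le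
  have hQ1 : (1 : ℝ) ≤ Q := ht1.trans htQ
  have hQ0 : (0 : ℝ) < Q := by linarith
  have ht0 : 0 < t := by linarith
  have hsρ : 0 < √ρ := Real.sqrt_pos.2 hρ
  set Y : ℝ := 2 * c * (Q / t) with hY
  have hY0 : 0 < Y := by positivity
  have hYQ : Y < Q := by
    calc Y < 1 * (Q / t) := by rw [hY]; gcongr
      _ ≤ Q := by rw [one_mul]; exact div_le_self hQ0.le ht1
  have hex : ∀ w, ∃ p : ℕ × ℕ, w ∈ W → (2 : ℝ) ^ (p.1 + 1) ≤ Y ∧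
      2 ^ (p.2 + 1) * √ρ * 2 ^ (p.1 + 1) ≤ 16 * K * t ∧
      ((T w).card : ℝ) ≤ 56 * K * t / (2 ^ (p.2 + 1) * √ρ * 2 ^ (p.1 + 1)) ∧
      0 < w.1 ∧ (w.1 : ℝ) ≤ 2 ^ (p.1 + 1) ∧ |χ (w.2.1 / w.1) - z| ≤ 2 ∧
      |g (w.2.1 / w.1) - w.2.2 / w.1| ≤ (2 ^ (p.2 + 1) * √ρ) ^ 2 := by
    intro w
    by_cases hw : w ∈ W
    · obtain ⟨p, hp⟩ := h.exists_dyadic hρ ht hKL (Y := Y) (by rw [hY]; linarith) hS (hW w hw).1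
        (hW w hw).2 (T w) (hT w)
      exact ⟨p, fun _ => hp⟩
    · exact ⟨(0, 0), fun hw' => absurd hw' hw⟩
  choose p hp using hex
  set B : ℕ × ℕ → ℝ := fun p => 280 * K ^ 2 * A * t *
    (2 ^ (p.2 + 1) * √ρ * 2 ^ (p.1 + 1) * 2 ^ (p.1 + 1) +
      √(2 ^ (p.2 + 1) * √ρ * 2 ^ (p.1 + 1)) * (2 ^ (p.1 + 1) * ((2 : ℝ) ^ (p.1 + 1)) ^ ε) +
      2 * (2 ^ (p.1 + 1) * ((2 : ℝ) ^ (p.1 + 1)) ^ ε) / (2 ^ (p.2 + 1) * √ρ * 2 ^ (p.1 + 1)))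
    with hB
  have hblock : ∀ a ∈ W.image p, ∑ w ∈ W.filter (fun w => p w = a), ((T w).card : ℝ) ≤ B a := by
    intro a ha
    obtain ⟨w₀, hw₀, hw₀a⟩ := Finset.mem_image.1 ha
    have hH := (hp w₀ hw₀).1
    rw [hw₀a] at hH
    set H : ℝ := 2 ^ (a.1 + 1) with hHdef
    have hH1 : 1 ≤ H := one_le_pow₀ (by norm_num)
    have hH0 : 0 < H := by linarith
    set x : ℝ := 2 ^ (a.2 + 1) * √ρ * H with hx
    have hx0 : 0 < x := by positivity
    have hHnat : ((2 ^ (a.1 + 1) : ℕ) : ℝ) = H := by rw [hHdef]; push_cast; rfl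
    set ρ' : ℝ := max (x ^ 2) 1 / H ^ 2 with hρ'
    have hρH : ρ' * H ^ 2 = max (x ^ 2) 1 := by rw [hρ']; field_simp
    have hρ'0 : 0 < ρ' := by positivity
    have hcard := h.card_tangential_le (H := 2 ^ (a.1 + 1)) (ρ := ρ') (z := z)
      (N := A * (x ^ 2 * H + x * √x * H ^ (1 + ε) + 2 * H ^ (1 + ε))) (by positivity) ?_
      (W.filter (fun w => p w = a)) ?_
    · calc ∑ w ∈ W.filter (fun w => p w = a), ((T w).card : ℝ)
          ≤ ∑ _w ∈ W.filter (fun w => p w = a), 56 * K * t / x := by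
            refine Finset.sum_le_sum fun w hw => ?_
            obtain ⟨hw', rfl⟩ := Finset.mem_filter.1 hw
            exact (hp w hw').2.2.1
        _ = (W.filter (fun w => p w = a)).card * (56 * K * t / x) := by
            rw [Finset.sum_const, nsmul_eq_mul]
        _ ≤ (A * (x ^ 2 * H + x * √x * H ^ (1 + ε) + 2 * H ^ (1 + ε)) * (5 * K)) *
            (56 * K * t / x) := by
            gcongr
            refine hcard.trans ?_
            gcongr
            linarith
        _ = B a := by
            rw [hB, Real.rpow_one_add' hH0.le (by linarith)]
            simp only [← hHdef, ← hx]
            field_simp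
            ring
    · intro z' S' hS'
      have := hIH (2 ^ (a.1 + 1)) (by
        have : ((2 ^ (a.1 + 1) : ℕ) : ℝ) < Q := by rw [hHnat]; linarith
        exact_mod_cast this) ρ' z' S' hρ'0 (by rw [hHnat, hρH]; exact le_max_right _ _) hS'
      rw [hHnat] at this
      exact this.trans (critical_bound_le hA hx0.le hH1 hε.le hρH)
    · intro w hw
      obtain ⟨hw, hwa⟩ := Finset.mem_filter.1 hw
      obtain ⟨-, -, -, p4, p5, p6, p7⟩ := hp w hw
      rw [hwa] at p5 p7
      refine ⟨(hW w hw).1.prim, p4, by rw [hHnat]; exact p5, p6, p7.trans ?_⟩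
      rw [hρ', le_div_iff₀ (by positivity), ← mul_pow]
      exact le_max_left _ _
  have hsum : ∑ w ∈ W, ((T w).card : ℝ) ≤ ∑ a ∈ W.image p, B a := by
    rw [← Finset.sum_fiberwise_of_maps_to (fun w hw => Finset.mem_image_of_mem p hw)]
    exact Finset.sum_le_sum hblock
  have hoff := sum_prod_le_of_fiber (W.image p) B
    (fun i => 280 * K ^ 2 * A * t * (32 * K * (t * 2 ^ (i + 1) +
      √t * (2 ^ (i + 1) * ((2 : ℝ) ^ (i + 1)) ^ ε) + Q / √t * ((2 : ℝ) ^ (i + 1)) ^ ε))) ?_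
  swap
  · intro i _ J hJ
    simp only [hB, ← Finset.mul_sum]
    refine mul_le_mul_of_nonneg_left ?_ (by positivity)
    refine sum_offset_le hK1 hρ hQ0 ht (by positivity) (by positivity) J fun j hj => ?_
    obtain ⟨w, hw, hwp⟩ := Finset.mem_image.1 (hJ j hj)
    have := (hp w hw).2.1
    rwa [hwp] at this
  have hhei := sum_height_le hY0 ht0 hQ0 hε ((W.image p).image Prod.fst) (by
    intro i hi
    obtain ⟨a, ha, rfl⟩ := Finset.mem_image.1 hi
    obtain ⟨w, hw, rfl⟩ := Finset.mem_image.1 ha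
    exact (hp w hw).1)
  set b : ℝ := 2 ^ ε / (2 ^ ε - 1) with hb
  have hb0 : 0 ≤ b := by
    have hr : (1 : ℝ) < 2 ^ ε := Real.one_lt_rpow (by norm_num) hε
    exact div_nonneg (by linarith) (by linarith)
  have hst0 : 0 < √t := Real.sqrt_pos.2 ht0
  have hc1 : 2 * c ≤ (2 * c) ^ ε := by
    conv_lhs => rw [← Real.rpow_one (2 * c)]
    exact Real.rpow_le_rpow_of_exponent_ge (by linarith) hc.le hε1
  have hYε : Y ^ ε ≤ (2 * c) ^ ε * (Q : ℝ) ^ ε := by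
    rw [← Real.mul_rpow (by linarith) hQ0.le]
    refine Real.rpow_le_rpow hY0.le ?_ hε.le
    rw [hY]
    gcongr
    exact div_le_self hQ0.le ht1
  have ht34 : √t ≤ t ^ (3 / 4 : ℝ) := by
    rw [Real.sqrt_eq_rpow]
    exact Real.rpow_le_rpow_of_exponent_le ht1 (by norm_num)
  have hYt : t * Y = 2 * c * Q := by rw [hY]; field_simp
  have hQε : (Q : ℝ) ^ (1 + ε) = Q * (Q : ℝ) ^ ε := Real.rpow_one_add' hQ0.le (by linarith)
  have hQt : t * (Q / √t) = √t * Q := by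
    have := Real.mul_self_sqrt ht0.le
    field_simp
    linarith
  have hfin : t * (2 * t * Y + 2 * √t * (Y * Y ^ ε) + b * (Q / √t * Y ^ ε)) ≤
      (b + 4) * (2 * c) ^ ε * (t * Q + t ^ (3 / 4 : ℝ) * (Q : ℝ) ^ (1 + ε)) := by
    have e : t * (2 * t * Y + 2 * √t * (Y * Y ^ ε) + b * (Q / √t * Y ^ ε)) =
        2 * t * (2 * c * Q) + 2 * √t * ((2 * c * Q) * Y ^ ε) + b * (√t * Q * Y ^ ε) := by
      rw [← hYt, ← hQt]; ring
    rw [e]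
    set η : ℝ := (2 * c) ^ ε with hη
    have hη0 : 0 ≤ η := by positivity
    have i1 : 2 * t * (2 * c * Q) ≤ 2 * t * (η * Q) := by gcongr
    have i2 : 2 * √t * ((2 * c * Q) * Y ^ ε) ≤
        2 * t ^ (3 / 4 : ℝ) * ((1 * Q) * (η * (Q : ℝ) ^ ε)) := by gcongr
    have i3 : b * (√t * Q * Y ^ ε) ≤ b * (t ^ (3 / 4 : ℝ) * Q * (η * (Q : ℝ) ^ ε)) := by gcongr
    rw [hQε]
    have j1 : 0 ≤ η * (t * Q) := by positivity
    have j2 : 0 ≤ η * (t ^ (3 / 4 : ℝ) * (Q * (Q : ℝ) ^ ε)) := by positivity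
    have j3 : 0 ≤ b * (η * (t * Q)) := by positivity
    linarith
  refine hsum.trans (hoff.trans ?_)
  rw [← Finset.mul_sum, ← Finset.mul_sum]
  calc _ ≤ 280 * K ^ 2 * A * t * (32 * K *
        (2 * t * Y + 2 * √t * (Y * Y ^ ε) + b * (Q / √t * Y ^ ε))) := by gcongr
    _ = 8960 * K ^ 3 * A *
        (t * (2 * t * Y + 2 * √t * (Y * Y ^ ε) + b * (Q / √t * Y ^ ε))) := by ring
    _ ≤ 8960 * K ^ 3 * A *
        ((b + 4) * (2 * c) ^ ε * (t * Q + t ^ (3 / 4 : ℝ) * (Q : ℝ) ^ (1 + ε))) := by gcongr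
    _ = _ := by ring

/-- A choice of the proximity scale making the dual contribution small. -/
lemma exists_proximity {K D ε : ℝ} (hD : 1 ≤ D) (hKD : K ≤ D) (hε : 0 < ε)
    (hε1 : ε ≤ 1) : ∃ c : ℝ, 0 < c ∧ 2 * c < 1 ∧ K * c ^ 2 ≤ 1 ∧ D * (2 * c) ^ ε ≤ 1 / 2 := by
  set y : ℝ := 1 / (2 * D) with hy
  have hy0 : 0 < y := by positivity
  have hy1 : y ≤ 1 / 2 := by
    rw [hy]; exact one_div_le_one_div_of_le (by norm_num) (by linarith)
  have hc : y ^ (1 / ε) ≤ y := by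
    conv_rhs => rw [← Real.rpow_one y]
    exact Real.rpow_le_rpow_of_exponent_ge hy0 (by linarith) ((one_le_div hε).2 hε1)
  have hc0 : 0 < y ^ (1 / ε) := by positivity
  have hDy : D * y = 1 / 2 := by rw [hy]; field_simp
  refine ⟨y ^ (1 / ε) / 2, by positivity, by linarith, ?_, ?_⟩
  · have h1 : (y ^ (1 / ε) / 2) ^ 2 ≤ y := by nlinarith
    calc K * (y ^ (1 / ε) / 2) ^ 2 ≤ D * y := by gcongr
      _ ≤ 1 := by linarith
  · rw [mul_div_cancel₀ _ (two_ne_zero), ← Real.rpow_mul hy0.le, one_div_mul_cancel hε.ne',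
      Real.rpow_one, hDy]

/-- The rational points near the curve split into isolated points and points on joining lines. -/
lemma exists_joining_lines {Q : ℕ} {ρ z L : ℝ} (hL : 0 < L) {S : Finset (ℤ × ℤ × ℤ)}
    (hS : ∀ v ∈ S, Near f Q ρ z v) :
    ∃ (W : Finset (ℤ × ℤ × ℤ)) (T : ℤ × ℤ × ℤ → Finset (ℤ × ℤ × ℤ)),
      (∀ w ∈ W, IsJoining S L w) ∧ (∀ w, ∀ v ∈ T w, v ∈ S ∧ Incident v w) ∧
      (S.card : ℝ) ≤ 1 + 2 / L + ∑ w ∈ W, ((T w).card : ℝ) := by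
  classical
  set X : ℤ × ℤ × ℤ → ℝ := fun v => v.2.1 / v.1 with hX
  set bad : ℤ × ℤ × ℤ → Prop := fun v => ∃ v' ∈ S, v ≠ v' ∧ |X v - X v'| ≤ L with hbad
  have hex : ∀ v, ∃ w, v ∈ S → bad v → IsJoining S L w ∧ Incident v w := by
    intro v
    by_cases hv : v ∈ S ∧ bad v
    · obtain ⟨hv, v', hv', hne, hd⟩ := hv
      obtain ⟨w, w1, w2, w3, w4⟩ := exists_line (hS v hv).prim (hS v' hv').prim (hS v hv).pos
        (hS v' hv').pos hne
      exact ⟨w, fun _ _ => ⟨⟨w1, w2, v, hv, v', hv', hne, w3, w4, hd⟩, w3⟩⟩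
    · exact ⟨0, fun h1 h2 => absurd ⟨h1, h2⟩ hv⟩
  choose w hw using hex
  refine ⟨(S.filter bad).image w, fun u => S.filter (fun v => Incident v u), ?_, ?_, ?_⟩
  · intro u hu
    obtain ⟨v, hv, rfl⟩ := Finset.mem_image.1 hu
    obtain ⟨hv, hb⟩ := Finset.mem_filter.1 hv
    exact (hw v hv hb).1
  · intro u v hv
    exact Finset.mem_filter.1 hv
  · have h1 : ((S.filter (fun v => ¬ bad v)).card : ℝ) ≤ 1 + 2 / L := by
      refine card_le_of_separated _ X hL (by norm_num) ?_ ?_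
      · intro x hx y hy
        have h1 := abs_le.1 (hS x (Finset.mem_filter.1 hx).1).window
        have h2 := abs_le.1 (hS y (Finset.mem_filter.1 hy).1).window
        simp only [hX]
        linarith
      · intro x hx y hy hne
        obtain ⟨hx, hbx⟩ := Finset.mem_filter.1 hx
        by_contra hlt
        exact hbx ⟨y, (Finset.mem_filter.1 hy).1, hne, (not_le.1 hlt).le⟩
    have h2 : ((S.filter bad).card : ℝ) ≤ ∑ u ∈ (S.filter bad).image w,
        ((S.filter (fun v => Incident v u)).card : ℝ) := by
      rw [Finset.card_eq_sum_card_image w (S.filter bad)]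
      push_cast
      refine Finset.sum_le_sum fun u _ => ?_
      refine Nat.cast_le.2 (Finset.card_le_card fun v hv => ?_)
      obtain ⟨hvb, rfl⟩ := Finset.mem_filter.1 hv
      obtain ⟨hv, hb⟩ := Finset.mem_filter.1 hvb
      exact Finset.mem_filter.2 ⟨hv, (hw v hv hb).2⟩
    have h3 := Finset.card_filter_add_card_filter_not (s := S) bad
    have h4 : (S.card : ℝ) = (S.filter bad).card + (S.filter (fun v => ¬ bad v)).card := by
      exact_mod_cast h3.symm
    rw [h4]
    linarith

/-- Upper bound for the number of rational points near a strictly convex curve. -/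
theorem exists_card_near_le (hK : 1 ≤ K) {ε : ℝ} (hε : 0 < ε) (hε1 : ε ≤ 1) :
    ∃ A : ℝ, 0 < A ∧ ∀ (Q : ℕ) (f g φ χ : ℝ → ℝ), DualPair K f g φ χ →
      ∀ (ρ z : ℝ) (S : Finset (ℤ × ℤ × ℤ)), 0 < ρ → 1 ≤ ρ * (Q : ℝ) ^ 2 →
      (∀ v ∈ S, Near f Q ρ z v) → (S.card : ℝ) ≤
        A * (ρ * Q ^ 2 * Q + (ρ * Q ^ 2) ^ (3 / 4 : ℝ) * (Q : ℝ) ^ (1 + ε)) := by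
  classical
  set b : ℝ := 2 ^ ε / (2 ^ ε - 1) with hb
  have hb0 : 0 ≤ b := by
    have hr : (1 : ℝ) < 2 ^ ε := Real.one_lt_rpow (by norm_num) hε
    exact div_nonneg (by linarith) (by linarith)
  have hK3 : K ≤ K ^ 3 := le_self_pow₀ hK (by norm_num)
  have hKD : K ≤ 8960 * K ^ 3 * (b + 4) := by
    calc K ≤ K ^ 3 := hK3
      _ ≤ K ^ 3 * (8960 * (b + 4)) := le_mul_of_one_le_right (by positivity) (by linarith)
      _ = _ := by ring
  obtain ⟨c, hc0, hc1, hKc, hDc⟩ := exists_proximity (hK.trans hKD) hKD hε hε1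
  set C : ℝ := 28 + 2 / c + 525 * (1 + K ^ 2) ^ 3 with hC
  have hC0 : 0 < C := by positivity
  have hC28 : 28 ≤ C := by
    have : 0 ≤ 2 / c + 525 * (1 + K ^ 2) ^ 3 := by positivity
    rw [hC]; linarith
  refine ⟨2 * C, by positivity, fun Q => ?_⟩
  induction Q using Nat.strong_induction_on with
  | _ Q ih =>
  intro f g φ χ h ρ z S hρ ht1 hS
  obtain ⟨t, ht⟩ : ∃ t, t = ρ * (Q : ℝ) ^ 2 := ⟨_, rfl⟩
  rw [← ht] at ht1 ⊢
  have ht0 : 0 < t := by linarith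
  have hQ : 0 < Q := by
    rcases Nat.eq_zero_or_pos Q with rfl | hQ
    · norm_num at ht; linarith
    · exact hQ
  have hQ1 : (1 : ℝ) ≤ Q := by exact_mod_cast hQ
  have hQ0 : (0 : ℝ) < Q := by linarith
  have hG0 : 0 ≤ t ^ (3 / 4 : ℝ) * (Q : ℝ) ^ (1 + ε) := by positivity
  have htQ1 : 1 ≤ t * Q := one_le_mul_of_one_le_of_one_le ht1 hQ1
  rcases le_total (Q : ℝ) t with htQ | htQ
  · refine (card_near_le_trivial ht htQ hQ S hS).trans ?_
    calc 27 * (t * Q) ≤ 2 * C * (t * Q) := by gcongr; linarith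
      _ ≤ _ := by gcongr; linarith
  set L : ℝ := c / (t * Q) with hL
  have hL0 : 0 < L := by positivity
  have hLQ : L * Q ^ 2 = c * (Q / t) := by rw [hL]; field_simp
  have hKL : K * L ^ 2 ≤ ρ := by
    have e : K * L ^ 2 = K * c ^ 2 / (t * Q) ^ 2 := by rw [hL]; ring
    have e2 : ρ = t / Q ^ 2 := by rw [ht]; field_simp
    rw [e, e2, div_le_div_iff₀ (by positivity) (by positivity)]
    have : (1 : ℝ) ≤ t ^ 3 := one_le_pow₀ ht1
    calc K * c ^ 2 * Q ^ 2 ≤ 1 * Q ^ 2 := by gcongr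
      _ ≤ t ^ 3 * Q ^ 2 := by gcongr
      _ = _ := by ring
  obtain ⟨W, T, hW, hT, hcard⟩ := exists_joining_lines hL0 hS
  have b1 := h.sum_transversal_le hρ ht ht1 htQ hL0.le hKL (by
    rw [hLQ]; exact mul_le_of_le_one_left (by positivity) (by linarith)) hS
    (W.filter (IsTransversal χ z))
    (fun w hw => ⟨hW w (Finset.mem_filter.1 hw).1, (Finset.mem_filter.1 hw).2⟩) T hT
  have b2 := h.sum_tangential_le hρ ht ht1 htQ (A := 2 * C) (by positivity) hε hε1 hc0 hc1 hKL
    hLQ.le (fun H hH ρ' z' S' hρ' ht' hS' => ih H hH g f χ φ h.symm ρ' z' S' hρ' ht' hS') hS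
    (W.filter (fun w => ¬ IsTransversal χ z w))
    (fun w hw => ⟨hW w (Finset.mem_filter.1 hw).1, (Finset.mem_filter.1 hw).2⟩) T hT
  rw [← Finset.sum_filter_add_sum_filter_not W (IsTransversal χ z)] at hcard
  set G : ℝ := t * Q + t ^ (3 / 4 : ℝ) * (Q : ℝ) ^ (1 + ε) with hG
  have b3 : 8960 * K ^ 3 * (b + 4) * (2 * c) ^ ε * (2 * C * G) ≤ 1 / 2 * (2 * C * G) :=
    mul_le_mul_of_nonneg_right hDc (by positivity)
  have b4 : 1 + 2 / L ≤ (1 + 2 / c) * (t * Q) := by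
    have : 2 / L = 2 / c * (t * Q) := by rw [hL]; field_simp
    rw [this]; linarith
  have b5 : (1 + 2 / c) * (t * Q) + 525 * (1 + K ^ 2) ^ 3 * (t * Q) ≤ C * G := by
    calc _ = (1 + 2 / c + 525 * (1 + K ^ 2) ^ 3) * (t * Q) := by ring
      _ ≤ C * G := by
        gcongr
        · rw [hC]; linarith
        · rw [hG]; linarith
  linarith

/-- The Hausdorff–Cantelli lemma. -/
lemma hausdorffMeasure_eq_zero_of_tsum_ne_top {X ι : Type*} [EMetricSpace X] [MeasurableSpace X]
    [BorelSpace X] [Countable ι] {s : ℝ} (hs : 0 < s) (U : ι → Set X)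
    (hU : ∑' i, Metric.ediam (U i) ^ s ≠ ⊤) (E : Set X)
    (hE : ∀ x ∈ E, {i | x ∈ U i}.Infinite) : μH[s] E = 0 := by
  set tail : Finset ι → ENNReal := fun F => ∑' i : {i // i ∉ F}, Metric.ediam (U i) ^ s with htail
  have hlim : Tendsto tail atTop (nhds 0) := ENNReal.tendsto_tsum_compl_atTop_zero hU
  have hr : Tendsto (fun F => tail F ^ s⁻¹) atTop (nhds 0) := by
    have := (ENNReal.continuous_rpow_const (y := s⁻¹)).tendsto 0 |>.comp hlim
    rwa [ENNReal.zero_rpow_of_pos (by positivity)] at this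
  have := Measure.hausdorffMeasure_le_liminf_tsum s E (l := atTop) (fun F => tail F ^ s⁻¹) hr
    (fun (F : Finset ι) (i : {i // i ∉ F}) => U i) ?_ ?_
  · rw [hlim.liminf_eq] at this
    exact nonpos_iff_eq_zero.1 this
  · refine Eventually.of_forall fun F i => ?_
    rw [ENNReal.le_rpow_inv_iff hs]
    exact ENNReal.le_tsum (f := fun i : {i // i ∉ F} => Metric.ediam (U i) ^ s) i
  · refine Eventually.of_forall fun F x hx => ?_
    obtain ⟨i, hi, hiF⟩ := (hE x hx).exists_notMem_finset F
    exact Set.mem_iUnion.2 ⟨⟨i, hiF⟩, hi⟩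

/-- A counting bound for finite subsets turns into a bound for the sum of constant weights. -/
lemma tsum_indicator_le {α : Type*} (p : α → Prop) [DecidablePred p] {N : ℝ} (w : ENNReal)
    (hN : ∀ S : Finset α, (∀ v ∈ S, p v) → (S.card : ℝ) ≤ N) :
    ∑' v, (if p v then w else 0) ≤ ENNReal.ofReal N * w := by
  rw [ENNReal.tsum_eq_iSup_sum]
  refine iSup_le fun S => ?_
  rw [← Finset.sum_filter, Finset.sum_const, nsmul_eq_mul]
  gcongr
  rw [← ENNReal.ofReal_natCast]
  exact ENNReal.ofReal_le_ofReal (hN _ fun v hv => (Finset.mem_filter.1 hv).2)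

/-- Cauchy condensation for the series in the convergence theorem. -/
lemma summable_condensed {ψ : ℕ → ℝ} (hψpos : ∀ q, 0 < ψ q) (hψdec : Antitone ψ) {s : ℝ}
    (hs0 : 0 < s) (hs1 : s ≤ 1)
    (hsum : Summable (fun h : ℕ => (h : ℝ) ^ (1 - s) * Real.log h ^ s * ψ h ^ s)) :
    Summable (fun n : ℕ => ((2 : ℝ) ^ n) ^ (2 - s) * (n : ℝ) ^ s * ψ (2 ^ n) ^ s) := by
  set a : ℕ → ℝ := fun h => (h : ℝ) ^ (1 - s) * Real.log h ^ s * ψ h ^ s with ha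
  have ha0 : ∀ h, 0 ≤ a h := fun h => by
    have := Real.log_natCast_nonneg h
    have := hψpos h
    positivity
  set b : ℕ → ℝ := fun n => ∑ h ∈ Finset.Ioc (2 ^ (n + 1)) (2 ^ (n + 2)), a h with hb
  have hb0 : ∀ n, 0 ≤ b n := fun n => Finset.sum_nonneg fun h _ => ha0 h
  have hbsum : Summable b := by
    refine summable_of_sum_range_le hb0 (c := ∑' h, a h) fun N => ?_
    have : ∑ n ∈ Finset.range N, b n = ∑ h ∈ Finset.Ioc 2 (2 ^ (N + 1)), a h := by
      induction N with
      | zero => simp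
      | succ N ih =>
        rw [Finset.sum_range_succ, ih, hb]
        refine Finset.sum_Ioc_consecutive a ?_ (Nat.pow_le_pow_right (by norm_num) (by lia))
        calc 2 = 2 ^ 1 := rfl
          _ ≤ 2 ^ (N + 1) := Nat.pow_le_pow_right (by norm_num) (by lia)
    rw [this]
    exact hsum.sum_le_tsum _ fun h _ => ha0 h
  have hlog : 0 < Real.log 2 := Real.log_pos (by norm_num)
  refine (summable_nat_add_iff 2).1 ?_
  refine Summable.of_nonneg_of_le (fun n => ?_) (fun n => ?_) (hbsum.mul_left (4 / Real.log 2 ^ s))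
  · have := hψpos (2 ^ (n + 2))
    positivity
  have hP := hψpos (2 ^ (n + 2))
  have hlow : (2 : ℝ) ^ (n + 1) * (((2 : ℝ) ^ (n + 1)) ^ (1 - s) *
      (((n + 1 : ℕ) : ℝ) * Real.log 2) ^ s * ψ (2 ^ (n + 2)) ^ s) ≤ b n := by
    have hcard : (Finset.Ioc (2 ^ (n + 1)) (2 ^ (n + 2))).card = 2 ^ (n + 1) := by
      rw [Nat.card_Ioc, pow_succ 2 (n + 1)]; lia
    have := Finset.card_nsmul_le_sum (Finset.Ioc (2 ^ (n + 1)) (2 ^ (n + 2))) a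
      (((2 : ℝ) ^ (n + 1)) ^ (1 - s) * (((n + 1 : ℕ) : ℝ) * Real.log 2) ^ s *
        ψ (2 ^ (n + 2)) ^ s) ?_
    · rw [hcard, nsmul_eq_mul] at this
      push_cast at this ⊢
      exact this
    · intro h hh
      obtain ⟨h1, h2⟩ := Finset.mem_Ioc.1 hh
      have h3 : (2 : ℝ) ^ (n + 1) ≤ h := by exact_mod_cast h1.le
      have h4 : ((n + 1 : ℕ) : ℝ) * Real.log 2 ≤ Real.log h := by
        rw [← Real.log_pow]
        exact Real.log_le_log (by positivity) h3
      have h5 := hψdec h2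
      have h6 := hψpos h
      have h7 : 0 ≤ 1 - s := by linarith
      have h8 : 0 ≤ ((n + 1 : ℕ) : ℝ) * Real.log 2 := by positivity
      simp only [ha]
      gcongr
  have e1 : ((2 : ℝ) ^ (n + 2)) ^ (2 - s) * ((n + 2 : ℕ) : ℝ) ^ s ≤
      4 * ((2 : ℝ) ^ (n + 1) * ((2 : ℝ) ^ (n + 1)) ^ (1 - s)) * ((n + 1 : ℕ) : ℝ) ^ s := by
    have f1 : ((2 : ℝ) ^ (n + 2)) ^ (2 - s) =
        2 ^ (2 - s) * ((2 : ℝ) ^ (n + 1) * ((2 : ℝ) ^ (n + 1)) ^ (1 - s)) := by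
      rw [pow_succ, Real.mul_rpow (by positivity) (by norm_num),
        ← Real.rpow_one_add' (by positivity) (by linarith), mul_comm]
      ring_nf
    have f2 : ((n + 2 : ℕ) : ℝ) ^ s ≤ 2 ^ s * ((n + 1 : ℕ) : ℝ) ^ s := by
      rw [← Real.mul_rpow (by norm_num) (by positivity)]
      refine Real.rpow_le_rpow (by positivity) ?_ hs0.le
      push_cast
      have : (0 : ℝ) ≤ n := by positivity
      linarith
    have f3 : (2 : ℝ) ^ (2 - s) * 2 ^ s = 4 := by
      rw [← Real.rpow_add (by norm_num)]; norm_num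
    calc _ ≤ 2 ^ (2 - s) * ((2 : ℝ) ^ (n + 1) * ((2 : ℝ) ^ (n + 1)) ^ (1 - s)) *
          (2 ^ s * ((n + 1 : ℕ) : ℝ) ^ s) := by rw [f1]; gcongr
      _ = (2 ^ (2 - s) * 2 ^ s) * ((2 : ℝ) ^ (n + 1) * ((2 : ℝ) ^ (n + 1)) ^ (1 - s)) *
          ((n + 1 : ℕ) : ℝ) ^ s := by ring
      _ = _ := by rw [f3]
  calc _ ≤ 4 * ((2 : ℝ) ^ (n + 1) * ((2 : ℝ) ^ (n + 1)) ^ (1 - s)) * ((n + 1 : ℕ) : ℝ) ^ s *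
        ψ (2 ^ (n + 2)) ^ s := by gcongr
    _ = 4 / Real.log 2 ^ s * ((2 : ℝ) ^ (n + 1) * (((2 : ℝ) ^ (n + 1)) ^ (1 - s) *
      (((n + 1 : ℕ) : ℝ) * Real.log 2) ^ s * ψ (2 ^ (n + 2)) ^ s)) := by
        rw [Real.mul_rpow (by positivity) hlog.le]
        field_simp
    _ ≤ _ := by gcongr

lemma exists_sum_pow_le {s : ℝ} (hs0 : 0 < s) (hs1 : s ≤ 1) :
    ∃ C : ℝ, 0 ≤ C ∧ ∀ n : ℕ, ∑ k ∈ Finset.range n, ((2 : ℝ) ^ (s - 1)) ^ k ≤ C * (n : ℝ) ^ s := by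
  rcases hs1.eq_or_lt with rfl | hs1
  · exact ⟨1, zero_le_one, fun n => by simp⟩
  have hy1 : (2 : ℝ) ^ (s - 1) < 1 := Real.rpow_lt_one_of_one_lt_of_neg (by norm_num) (by linarith)
  have hy0 : (0 : ℝ) < 2 ^ (s - 1) := by positivity
  have hC : 0 ≤ (1 - (2 : ℝ) ^ (s - 1))⁻¹ := inv_nonneg.2 (by linarith)
  refine ⟨(1 - (2 : ℝ) ^ (s - 1))⁻¹, hC, fun n => ?_⟩
  rcases Nat.eq_zero_or_pos n with rfl | hn
  · simp [Real.zero_rpow hs0.ne']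
  have h1 : (1 : ℝ) ≤ (n : ℝ) ^ s := Real.one_le_rpow (by exact_mod_cast hn) hs0.le
  calc _ ≤ (1 - (2 : ℝ) ^ (s - 1))⁻¹ :=
        sum_le_hasSum _ (fun _ _ => by positivity) (hasSum_geometric_of_lt_one hy0.le hy1)
    _ ≤ _ := le_mul_of_one_le_right hC h1

/-- The total cost of the covers is summable over the dyadic heights. -/
lemma summable_cost {ψ : ℕ → ℝ} (hψpos : ∀ q, 0 < ψ q) {s : ℝ} (hs0 : 0 < s) (hs1 : s ≤ 1)
    (hsum : Summable (fun n : ℕ => ((2 : ℝ) ^ n) ^ (2 - s) * (n : ℝ) ^ s * ψ (2 ^ n) ^ s)) :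
    Summable (fun n : ℕ =>
      ∑ k ∈ Finset.range ⌊(1 - s / 4) * n⌋₊,
        4 ^ n / 2 ^ k * (2 ^ (k + 1) * ψ (2 ^ n) / 2 ^ n) ^ s +
      4 ^ n / 2 ^ ⌊(1 - s / 4) * n⌋₊ * (√(ψ (2 ^ n)) / 2 ^ n) ^ s) := by
  refine Summable.add ?_ ?_
  · obtain ⟨C, hC, hCn⟩ := exists_sum_pow_le hs0 hs1
    refine Summable.of_nonneg_of_le (fun n => ?_) (fun n => ?_) (hsum.mul_left (2 ^ s * C))
    · have := hψpos (2 ^ n)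
      positivity
    have hP := hψpos (2 ^ n)
    have hterm : ∀ k : ℕ, (4 : ℝ) ^ n / 2 ^ k * (2 ^ (k + 1) * ψ (2 ^ n) / 2 ^ n) ^ s =
        2 ^ s * (((2 : ℝ) ^ n) ^ (2 - s) * ψ (2 ^ n) ^ s) * ((2 : ℝ) ^ (s - 1)) ^ k := by
      intro k
      have e1 : ((2 : ℝ) ^ (s - 1)) ^ k = (2 ^ k) ^ s / 2 ^ k := by
        rw [← Real.rpow_natCast, ← Real.rpow_mul (by norm_num), mul_comm,
          Real.rpow_mul (by norm_num), Real.rpow_natCast, Real.rpow_sub_one (by positivity)]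
      have e2 : ((2 : ℝ) ^ n) ^ (2 - s) = 4 ^ n / (2 ^ n) ^ s := by
        rw [Real.rpow_sub (by positivity)]
        congr 1
        rw [Real.rpow_two, ← pow_mul, mul_comm, pow_mul]
        norm_num
      rw [e1, e2, pow_succ, Real.div_rpow (by positivity) (by positivity),
        Real.mul_rpow (by positivity) hP.le, Real.mul_rpow (by positivity) (by norm_num)]
      field_simp
    simp only [hterm]
    rw [← Finset.mul_sum]
    have hfl : ⌊(1 - s / 4) * n⌋₊ ≤ n := by
      refine Nat.floor_le_of_le ?_
      have : (0 : ℝ) ≤ n := by positivity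
      nlinarith
    have hle : ∑ k ∈ Finset.range ⌊(1 - s / 4) * n⌋₊, ((2 : ℝ) ^ (s - 1)) ^ k ≤ C * (n : ℝ) ^ s :=
      (Finset.sum_le_sum_of_subset_of_nonneg (Finset.range_mono hfl)
        (fun _ _ _ => by positivity)).trans (hCn n)
    calc _ ≤ 2 ^ s * (((2 : ℝ) ^ n) ^ (2 - s) * ψ (2 ^ n) ^ s) * (C * (n : ℝ) ^ s) := by gcongr
      _ = _ := by ring
  · obtain ⟨M, hM0, hM⟩ : ∃ M : ℝ, 0 ≤ M ∧
        ∀ n : ℕ, ψ (2 ^ n) ^ s ≤ M * ((2 : ℝ) ^ n) ^ (s - 2) := by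
      have hnn : ∀ n : ℕ, 0 ≤ ((2 : ℝ) ^ n) ^ (2 - s) * (n : ℝ) ^ s * ψ (2 ^ n) ^ s := fun n => by
        have := hψpos (2 ^ n)
        positivity
      have hψ1 := hψpos 1
      have ht0 : 0 ≤ ∑' n : ℕ, ((2 : ℝ) ^ n) ^ (2 - s) * (n : ℝ) ^ s * ψ (2 ^ n) ^ s :=
        tsum_nonneg hnn
      refine ⟨(∑' n : ℕ, ((2 : ℝ) ^ n) ^ (2 - s) * (n : ℝ) ^ s * ψ (2 ^ n) ^ s) + ψ 1 ^ s,
        by positivity, fun n => ?_⟩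
      have hP := hψpos (2 ^ n)
      rcases Nat.eq_zero_or_pos n with rfl | hn
      · simpa using ht0
      have h1 : (1 : ℝ) ≤ (n : ℝ) ^ s := Real.one_le_rpow (by exact_mod_cast hn) hs0.le
      have h2 := hsum.le_tsum n (fun m _ => hnn m)
      have e : ((2 : ℝ) ^ n) ^ (2 - s) * ((2 : ℝ) ^ n) ^ (s - 2) = 1 := by
        rw [← Real.rpow_add (by positivity)]; simp
      calc ψ (2 ^ n) ^ s =
          ((2 : ℝ) ^ n) ^ (2 - s) * 1 * ψ (2 ^ n) ^ s * ((2 : ℝ) ^ n) ^ (s - 2) := by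
            rw [mul_one, mul_right_comm, e, one_mul]
        _ ≤ ((2 : ℝ) ^ n) ^ (2 - s) * (n : ℝ) ^ s * ψ (2 ^ n) ^ s * ((2 : ℝ) ^ n) ^ (s - 2) := by
            gcongr
        _ ≤ _ := by
            refine mul_le_mul_of_nonneg_right ?_ (by positivity)
            have : 0 ≤ ψ 1 ^ s := by positivity
            linarith
    have hgeo : Summable (fun n : ℕ => 2 * √M * ((2 : ℝ) ^ (-(s / 4))) ^ n) :=
      (summable_geometric_of_lt_one (by positivity)
        (Real.rpow_lt_one_of_one_lt_of_neg (by norm_num) (by linarith))).mul_left _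
    refine Summable.of_nonneg_of_le (fun n => by positivity) (fun n => ?_) hgeo
    have hP := hψpos (2 ^ n)
    have hX : (0 : ℝ) < 2 ^ n := by positivity
    have h1 : √(ψ (2 ^ n)) ^ s ≤ √M * ((2 : ℝ) ^ n) ^ ((s - 2) / 2) := by
      calc √(ψ (2 ^ n)) ^ s = √(ψ (2 ^ n) ^ s) := by
            rw [Real.sqrt_eq_rpow, Real.sqrt_eq_rpow, ← Real.rpow_mul hP.le, ← Real.rpow_mul hP.le,
              mul_comm]
        _ ≤ √(M * ((2 : ℝ) ^ n) ^ (s - 2)) := Real.sqrt_le_sqrt (hM n)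
        _ = _ := by
            rw [Real.sqrt_mul hM0]
            congr 1
            rw [Real.sqrt_eq_rpow, ← Real.rpow_mul hX.le]
            ring_nf
    have h2 : ((2 : ℝ) ^ n) ^ (1 - s / 4) ≤ 2 * 2 ^ ⌊(1 - s / 4) * n⌋₊ := by
      have := (Nat.lt_floor_add_one ((1 - s / 4) * n)).le
      rw [← pow_succ', ← Real.rpow_natCast 2 n, ← Real.rpow_mul (by norm_num), mul_comm (n : ℝ),
        ← Real.rpow_natCast 2 (_ + 1)]
      refine Real.rpow_le_rpow_of_exponent_le (by norm_num) ?_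
      rw [Nat.cast_add_one]
      linarith
    have h3 : (4 : ℝ) ^ n = ((2 : ℝ) ^ n) ^ (2 : ℝ) := by
      rw [Real.rpow_two, ← pow_mul, mul_comm, pow_mul]
      norm_num
    have h4 : ((2 : ℝ) ^ (-(s / 4))) ^ n = ((2 : ℝ) ^ n) ^ (-(s / 4)) := by
      rw [← Real.rpow_natCast, ← Real.rpow_natCast, ← Real.rpow_mul (by norm_num),
        ← Real.rpow_mul (by norm_num), mul_comm]
    have h5 : (4 : ℝ) ^ n / 2 ^ ⌊(1 - s / 4) * n⌋₊ ≤ 2 * ((2 : ℝ) ^ n) ^ (1 + s / 4) := by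
      rw [div_le_iff₀ (by positivity)]
      calc (4 : ℝ) ^ n = ((2 : ℝ) ^ n) ^ (1 + s / 4) * ((2 : ℝ) ^ n) ^ (1 - s / 4) := by
            rw [h3, ← Real.rpow_add hX]; ring_nf
        _ ≤ ((2 : ℝ) ^ n) ^ (1 + s / 4) * (2 * 2 ^ ⌊(1 - s / 4) * n⌋₊) := by gcongr
        _ = _ := by ring
    rw [Real.div_rpow (by positivity) hX.le, h4]
    calc _ ≤ 2 * ((2 : ℝ) ^ n) ^ (1 + s / 4) *
          (√M * ((2 : ℝ) ^ n) ^ ((s - 2) / 2) / ((2 : ℝ) ^ n) ^ s) := by gcongr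
      _ = 2 * √M * (((2 : ℝ) ^ n) ^ (1 + s / 4) * ((2 : ℝ) ^ n) ^ ((s - 2) / 2) /
          ((2 : ℝ) ^ n) ^ s) := by ring
      _ = _ := by
          rw [← Real.rpow_add hX, ← Real.rpow_sub hX]
          ring_nf

lemma nint_eq (x : ℝ) : nint x = |x - round x| :=
  le_antisymm (ciInf_le ⟨0, by rintro _ ⟨z, rfl⟩; exact abs_nonneg _⟩ (round x))
    (le_ciInf fun z => round_le x z)

lemma nint_neg (x : ℝ) : nint (-x) = nint x := by
  have key : ∀ y : ℝ, nint (-y) ≤ nint y := fun y => by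
    rw [nint_eq y]
    refine (ciInf_le ⟨0, by rintro _ ⟨z, rfl⟩; exact abs_nonneg _⟩ (-round y)).trans_eq ?_
    rw [← abs_neg]
    push_cast
    ring_nf
  refine le_antisymm (key x) ?_
  simpa using key (-x)

/-- The primitive triple `(q, a, b)` is a multiplicative approximation of `(x, y)`. -/
structure Approx (ψ : ℕ → ℝ) (x y : ℝ) (v : ℤ × ℤ × ℤ) : Prop where
  prim : IsPrimitive v
  pos : 0 < v.1
  fst : |v.1 * x - v.2.1| ≤ 1 / 2
  snd : |v.1 * y - v.2.2| ≤ 1 / 2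
  prod : |v.1 * x - v.2.1| * |v.1 * y - v.2.2| < ψ v.1.toNat

lemma exists_approx {ψ : ℕ → ℝ} (hψdec : Antitone ψ) {x y : ℝ} {q : ℕ} (hq : 0 < q)
    (h : nint (q * x) * nint (q * y) < ψ q) :
    ∃ v, Approx ψ x y v ∧ ∃ g : ℤ, 0 < g ∧ (q : ℤ) = g * v.1 ∧ g * |v.1 * x - v.2.1| ≤ 1 / 2 := by
  obtain ⟨g, w, hg, hw, e1, e2, e3⟩ := exists_isPrimitive_mul q (round (q * x)) (round (q * y))
    (fun h => by lia)
  have hw1 : 0 < w.1 := by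
    by_contra hcon
    have : g * w.1 ≤ 0 := mul_nonpos_of_nonneg_of_nonpos hg.le (not_lt.1 hcon)
    lia
  have hg1 : (1 : ℝ) ≤ g := by exact_mod_cast hg
  have hg0 : (0 : ℝ) < g := by linarith
  have r1 : (q : ℝ) = g * w.1 := by exact_mod_cast e1
  have r2 : ((round (q * x) : ℤ) : ℝ) = g * w.2.1 := by exact_mod_cast e2
  have r3 : ((round (q * y) : ℤ) : ℝ) = g * w.2.2 := by exact_mod_cast e3
  have a1 := abs_sub_round ((q : ℝ) * x)
  have a2 := abs_sub_round ((q : ℝ) * y)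
  rw [nint_eq, nint_eq] at h
  have s1 : |(q : ℝ) * x - round ((q : ℝ) * x)| = g * |w.1 * x - w.2.1| := by
    rw [r2, r1, ← abs_of_pos hg0, ← abs_mul, abs_of_pos hg0]; ring_nf
  have s2 : |(q : ℝ) * y - round ((q : ℝ) * y)| = g * |w.1 * y - w.2.2| := by
    rw [r3, r1, ← abs_of_pos hg0, ← abs_mul, abs_of_pos hg0]; ring_nf
  rw [s1, s2] at h
  rw [s1] at a1
  rw [s2] at a2
  have n1 := abs_nonneg ((w.1 : ℝ) * x - w.2.1)
  have n2 := abs_nonneg ((w.1 : ℝ) * y - w.2.2)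
  have hle : w.1.toNat ≤ q := by
    have : w.1 ≤ g * w.1 := le_mul_of_one_le_left hw1.le hg
    lia
  refine ⟨w, ⟨hw, hw1, (le_mul_of_one_le_left n1 hg1).trans a1,
    (le_mul_of_one_le_left n2 hg1).trans a2, ?_⟩, g, hg, e1, a1⟩
  calc _ ≤ (g * |w.1 * x - w.2.1|) * (g * |w.1 * y - w.2.2|) :=
        mul_le_mul (le_mul_of_one_le_left n1 hg1) (le_mul_of_one_le_left n2 hg1) n2 (by positivity)
    _ < ψ q := h
    _ ≤ _ := hψdec hle

/-- An irrational abscissa that is approximable infinitely often has infinitely many primitive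
approximations. -/
lemma infinite_approx {ψ : ℕ → ℝ} (hψdec : Antitone ψ) {x y : ℝ} (hx : Irrational x)
    (h : {q : ℕ | 0 < q ∧ nint (q * x) * nint (q * y) < ψ q}.Infinite) :
    {v | Approx ψ x y v}.Infinite := by
  intro hfin
  refine h ((hfin.biUnion (t := fun v => Set.Iic ⌊(v.1 : ℝ) / (2 * |v.1 * x - v.2.1|)⌋₊)
    fun v _ => Set.finite_Iic _).subset ?_)
  rintro q ⟨hq, hlt⟩
  obtain ⟨v, hv, g, hg, e, hle⟩ := exists_approx hψdec hq hlt
  refine Set.mem_biUnion (show v ∈ {v | Approx ψ x y v} from hv) ?_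
  have hv0 : (0 : ℝ) < v.1 := by exact_mod_cast hv.pos
  have hm : 0 < |(v.1 : ℝ) * x - v.2.1| := by
    rw [abs_pos, sub_ne_zero]
    intro h0
    exact (hx.intCast_mul hv.pos.ne').ne_int _ h0
  refine Nat.le_floor ?_
  have r1 : (q : ℝ) = g * v.1 := by exact_mod_cast e
  rw [le_div_iff₀ (by positivity), r1]
  nlinarith

/-- Classification of an approximation by the sizes of its denominator and its larger error. -/
lemma Approx.exists_scale {ψ : ℕ → ℝ} (hψdec : Antitone ψ) {x y : ℝ} {v : ℤ × ℤ × ℤ}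
    (hv : Approx ψ x y v) (N : ℕ → ℕ) :
    ∃ n k : ℕ, (2 : ℝ) ^ n ≤ v.1 ∧ (v.1 : ℝ) ≤ 2 ^ (n + 1) ∧ k ≤ N n ∧
      |v.1 * x - v.2.1| ≤ 1 / 2 ^ k ∧ |v.1 * y - v.2.2| ≤ 1 / 2 ^ k ∧
      min |v.1 * x - v.2.1| |v.1 * y - v.2.2| ≤
        if k < N n then 2 ^ (k + 1) * ψ (2 ^ n) else √(ψ (2 ^ n)) := by
  have hq : v.1.toNat ≠ 0 := by have := hv.pos; lia
  have hcast : ((v.1.toNat : ℕ) : ℝ) = v.1 := by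
    have : ((v.1.toNat : ℕ) : ℤ) = v.1 := Int.toNat_of_nonneg hv.pos.le
    exact_mod_cast this
  set n := Nat.log 2 v.1.toNat with hn
  have h1 : 2 ^ n ≤ v.1.toNat := Nat.pow_log_le_self 2 hq
  have h2 : v.1.toNat < 2 ^ (n + 1) := Nat.lt_pow_succ_log_self (by norm_num) _
  have h1' : (2 : ℝ) ^ n ≤ v.1 := by rw [← hcast]; exact_mod_cast h1
  have h2' : (v.1 : ℝ) ≤ 2 ^ (n + 1) := by rw [← hcast]; exact_mod_cast h2.le
  have hp := hv.prod.trans_le (hψdec h1)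
  have f1 := hv.fst
  have f2 := hv.snd
  set a := |(v.1 : ℝ) * x - v.2.1|
  set b := |(v.1 : ℝ) * y - v.2.2|
  have ha : 0 ≤ a := abs_nonneg _
  have hb : 0 ≤ b := abs_nonneg _
  have hmm : min a b * max a b < ψ (2 ^ n) := by rwa [min_mul_max]
  have hm0 : 0 ≤ min a b := le_min ha hb
  by_cases hmax : max a b ≤ 1 / 2 ^ N n
  · refine ⟨n, N n, h1', h2', le_rfl, (le_max_left _ _).trans hmax,
      (le_max_right _ _).trans hmax, ?_⟩
    rw [if_neg (lt_irrefl _)]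
    refine Real.le_sqrt_of_sq_le (le_of_lt (lt_of_le_of_lt ?_ hmm))
    rw [sq]
    exact mul_le_mul_of_nonneg_left min_le_max hm0
  · push Not at hmax
    have hmaxpos : 0 < max a b := lt_trans (by positivity) hmax
    obtain ⟨k, hk1, hk2⟩ := exists_nat_pow_near_of_lt_one hmaxpos
      (show max a b ≤ 1 from max_le (by linarith) (by linarith))
      (show (0 : ℝ) < 1 / 2 by norm_num) (by norm_num)
    have hkN : k < N n := by
      by_contra hcon
      have : (1 / 2 : ℝ) ^ k ≤ (1 / 2) ^ N n :=
        pow_le_pow_of_le_one (by norm_num) (by norm_num) (not_lt.1 hcon)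
      rw [one_div_pow] at this
      rw [one_div_pow 2 (N n)] at this
      rw [one_div_pow] at hk2
      linarith
    rw [one_div_pow] at hk2 hk1
    refine ⟨n, k, h1', h2', hkN.le, (le_max_left _ _).trans hk2, (le_max_right _ _).trans hk2, ?_⟩
    rw [if_pos hkN]
    rw [div_lt_iff₀ (by positivity)] at hk1
    have : min a b * 1 ≤ min a b * (max a b * 2 ^ (k + 1)) :=
      mul_le_mul_of_nonneg_left hk1.le hm0
    have h3 : min a b * max a b * 2 ^ (k + 1) ≤ ψ (2 ^ n) * 2 ^ (k + 1) :=
      mul_le_mul_of_nonneg_right hmm.le (by positivity)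
    linarith

/-- A uniform bound for the number of rational points in the slabs that enter the cover. -/
lemma exists_card_slab_le (h : DualPair K f g φ χ) (hK : 1 ≤ K) {s Λ : ℝ} (hs0 : 0 < s)
    (hs1 : s ≤ 1) (hΛ : 0 ≤ Λ) (z : ℝ) :
    ∃ B : ℝ, 0 < B ∧ ∀ n k : ℕ, k ≤ ⌊(1 - s / 4) * n⌋₊ → ∀ S : Finset (ℤ × ℤ × ℤ),
      (∀ v ∈ S, Near f (2 ^ (n + 1)) ((1 + Λ) / 2 ^ k / 2 ^ n) z v) →
      (S.card : ℝ) ≤ B * (4 ^ n / 2 ^ k) := by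
  obtain ⟨A, hA, hcard⟩ := exists_card_near_le hK (ε := s / 16) (by linarith) (by linarith)
  refine ⟨A * (24 * (1 + Λ)), by positivity, fun n k hk S hS => ?_⟩
  have hkn : (k : ℝ) ≤ (1 - s / 4) * n := by
    have h0 : 0 ≤ (1 - s / 4) * (n : ℝ) := mul_nonneg (by linarith) (by positivity)
    exact (Nat.cast_le.2 hk).trans (Nat.floor_le h0)
  set Q : ℕ := 2 ^ (n + 1) with hQ
  have hQr : (Q : ℝ) = 2 * 2 ^ n := by rw [hQ]; push_cast; rw [pow_succ']
  set t : ℝ := (1 + Λ) / 2 ^ k / 2 ^ n * (Q : ℝ) ^ 2 with ht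
  have htval : t = 4 * (1 + Λ) * (2 ^ n / 2 ^ k) := by
    rw [ht, hQr]; field_simp; ring
  have hQ0 : (0 : ℝ) < Q := by rw [hQr]; positivity
  have hpow : (Q : ℝ) ^ (s / 4) ≤ t := by
    have h1 : (Q : ℝ) ^ (s / 4) ≤ 2 * ((2 : ℝ) ^ n) ^ (s / 4) := by
      rw [hQr, Real.mul_rpow (by norm_num) (by positivity)]
      gcongr
      exact Real.rpow_le_self_of_one_le (by norm_num) (by linarith)
    have h2 : ((2 : ℝ) ^ n) ^ (s / 4) ≤ 2 ^ n / 2 ^ k := by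
      rw [← Real.rpow_natCast 2 n, ← Real.rpow_natCast 2 k, ← Real.rpow_mul (by norm_num),
        ← Real.rpow_sub (by norm_num)]
      refine Real.rpow_le_rpow_of_exponent_le (by norm_num) ?_
      linarith
    rw [htval]
    have h3 : (0 : ℝ) < 2 ^ n / 2 ^ k := by positivity
    nlinarith
  have hQ1 : (1 : ℝ) ≤ Q := by
    rw [hQr]
    have : (1 : ℝ) ≤ 2 ^ n := one_le_pow₀ (by norm_num)
    linarith
  have ht1 : 1 ≤ t := (Real.one_le_rpow hQ1 (by linarith)).trans hpow
  have ht0 : 0 < t := by linarith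
  have h1 := hcard Q f g φ χ h ((1 + Λ) / 2 ^ k / 2 ^ n) z S (by positivity) ht1 hS
  rw [← ht] at h1
  have h2 : t ^ (3 / 4 : ℝ) * (Q : ℝ) ^ (1 + s / 16) ≤ t * Q := by
    have e1 : (Q : ℝ) ^ (1 + s / 16) = ((Q : ℝ) ^ (s / 4)) ^ (1 / 4 : ℝ) * Q := by
      rw [← Real.rpow_mul hQ0.le, Real.rpow_add hQ0, Real.rpow_one, mul_comm]
      ring_nf
    have e2 : t ^ (3 / 4 : ℝ) * t ^ (1 / 4 : ℝ) = t := by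
      rw [← Real.rpow_add ht0]; norm_num
    calc _ ≤ t ^ (3 / 4 : ℝ) * (t ^ (1 / 4 : ℝ) * Q) := by rw [e1]; gcongr
      _ = _ := by rw [← mul_assoc, e2]
  calc (S.card : ℝ) ≤ A * (t * Q + t * Q) := h1.trans (by gcongr)
    _ = A * (16 * (1 + Λ)) * (2 ^ n * 2 ^ n / 2 ^ k) := by rw [htval, hQr]; ring
    _ = A * (16 * (1 + Λ)) * (4 ^ n / 2 ^ k) := by rw [← mul_pow]; norm_num
    _ ≤ _ := by gcongr; norm_num

/-- The radius of the covering sets at the scale `(n, k)`. -/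
noncomputable def coverRadius (ψ : ℕ → ℝ) (N : ℕ → ℕ) (n k : ℕ) : ℝ :=
  (if k < N n then 2 ^ (k + 1) * ψ (2 ^ n) else √(ψ (2 ^ n))) / 2 ^ n

lemma coverRadius_nonneg {ψ : ℕ → ℝ} (hψpos : ∀ q, 0 < ψ q) (N : ℕ → ℕ) (n k : ℕ) :
    0 ≤ coverRadius ψ N n k := by
  have := hψpos (2 ^ n)
  unfold coverRadius
  split_ifs <;> positivity

lemma sum_coverRadius (ψ : ℕ → ℝ) (N : ℕ → ℕ) (n : ℕ) (s : ℝ) :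
    ∑ k ∈ Finset.range (N n + 1), 4 ^ n / 2 ^ k * coverRadius ψ N n k ^ s =
      ∑ k ∈ Finset.range (N n), 4 ^ n / 2 ^ k * (2 ^ (k + 1) * ψ (2 ^ n) / 2 ^ n) ^ s +
        4 ^ n / 2 ^ N n * (√(ψ (2 ^ n)) / 2 ^ n) ^ s := by
  rw [Finset.sum_range_succ]
  congr 1
  · refine Finset.sum_congr rfl fun k hk => ?_
    rw [coverRadius, if_pos (Finset.mem_range.1 hk)]
  · rw [coverRadius, if_neg (lt_irrefl _)]

open Classical in
/-- The covering set attached to a rational point; `side` selects the coordinate that is close. -/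
noncomputable def coverSet (f : ℝ → ℝ) (ψ : ℕ → ℝ) (N : ℕ → ℕ) (Λ z : ℝ) (J : Set ℝ)
    (i : Bool × ℕ × ℕ × ℤ × ℤ × ℤ) : Set ℝ :=
  if i.2.2.1 ≤ N i.2.1 ∧
      Near f (2 ^ (i.2.1 + 1)) ((1 + Λ) / 2 ^ i.2.2.1 / 2 ^ i.2.1) z i.2.2.2 then
    {x ∈ J | bif i.1 then |x - i.2.2.2.2.1 / i.2.2.2.1| ≤ coverRadius ψ N i.2.1 i.2.2.1
      else |f x - i.2.2.2.2.2 / i.2.2.2.1| ≤ coverRadius ψ N i.2.1 i.2.2.1}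
  else ∅

lemma ediam_le_of_forall_abs_sub_le {f : ℝ → ℝ} {J U : Set ℝ} {c δ y : ℝ} (hc : 0 < c)
    (hf : ∀ x ∈ J, ∀ x' ∈ J, c * |x - x'| ≤ |f x - f x'|) (hUJ : U ⊆ J)
    (hU : ∀ x ∈ U, |f x - y| ≤ δ) : Metric.ediam U ≤ ENNReal.ofReal (2 / c * δ) := by
  refine Metric.ediam_le fun x hx x' hx' => ?_
  rw [edist_dist, Real.dist_eq]
  refine ENNReal.ofReal_le_ofReal ?_
  have h1 := hf x (hUJ hx) x' (hUJ hx')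
  have h2 : |f x - f x'| ≤ 2 * δ := by
    have h3 := abs_le.1 (hU x hx)
    have h4 := abs_le.1 (hU x' hx')
    rw [abs_le]
    constructor <;> linarith
  rw [div_mul_eq_mul_div, le_div_iff₀ hc]
  linarith

open Classical in
lemma ediam_coverSet_rpow_le {f : ℝ → ℝ} {ψ : ℕ → ℝ} (hψpos : ∀ q, 0 < ψ q) {J : Set ℝ}
    {c s : ℝ} (hc : 0 < c) (hs : 0 < s)
    (hf : ∀ x ∈ J, ∀ x' ∈ J, c * |x - x'| ≤ |f x - f x'|) (N : ℕ → ℕ) (Λ z : ℝ)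
    (b : Bool) (n k : ℕ) (v : ℤ × ℤ × ℤ) :
    Metric.ediam (coverSet f ψ N Λ z J (b, n, k, v)) ^ s ≤
      if k ≤ N n then
        (if Near f (2 ^ (n + 1)) ((1 + Λ) / 2 ^ k / 2 ^ n) z v then
          ENNReal.ofReal ((2 + 2 / c) ^ s * coverRadius ψ N n k ^ s) else 0) else 0 := by
  have hr := coverRadius_nonneg hψpos N n k
  rw [← ite_and, coverSet]
  split_ifs with h
  · rw [← Real.mul_rpow (by positivity) hr,
      ← ENNReal.ofReal_rpow_of_nonneg (by positivity) hs.le]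
    refine ENNReal.rpow_le_rpow ?_ hs.le
    have h2c : 0 < 2 / c := by positivity
    cases b
    · refine (ediam_le_of_forall_abs_sub_le hc hf (Set.sep_subset _ _)
        (fun x hx => hx.2)).trans (ENNReal.ofReal_le_ofReal ?_)
      exact mul_le_mul_of_nonneg_right (by linarith) hr
    · refine (ediam_le_of_forall_abs_sub_le (f := id) one_pos (J := J) (by simp)
        (Set.sep_subset _ _) (fun x hx => hx.2)).trans (ENNReal.ofReal_le_ofReal ?_)
      exact mul_le_mul_of_nonneg_right (by linarith) hr
  · simp [hs]

open Classical in
lemma tsum_coverSet_ne_top (h : DualPair K f g φ χ) (hK : 1 ≤ K) {ψ : ℕ → ℝ}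
    (hψpos : ∀ q, 0 < ψ q) {s c Λ z : ℝ} (hs0 : 0 < s) (hs1 : s ≤ 1) (hΛ : 0 ≤ Λ) (hc : 0 < c)
    {J : Set ℝ} (hf : ∀ x ∈ J, ∀ x' ∈ J, c * |x - x'| ≤ |f x - f x'|)
    (hsum : Summable (fun n : ℕ => ((2 : ℝ) ^ n) ^ (2 - s) * (n : ℝ) ^ s * ψ (2 ^ n) ^ s)) :
    ∑' i, Metric.ediam (coverSet f ψ (fun n => ⌊(1 - s / 4) * n⌋₊) Λ z J i) ^ s ≠ ⊤ := by
  obtain ⟨B, hB, hcard⟩ := exists_card_slab_le h hK hs0 hs1 hΛ z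
  set N : ℕ → ℕ := fun n => ⌊(1 - s / 4) * n⌋₊ with hN
  set cost : ℕ → ℝ := fun n =>
    ∑ k ∈ Finset.range (N n + 1), 4 ^ n / 2 ^ k * coverRadius ψ N n k ^ s with hcost
  have hcs : Summable cost := by
    simp only [hcost, sum_coverRadius]
    exact summable_cost hψpos hs0 hs1 hsum
  set w : ℝ := (2 + 2 / c) ^ s with hw
  have hw0 : 0 ≤ w := by positivity
  have hslab : ∀ n k, k ≤ N n → ∑' v : ℤ × ℤ × ℤ,
      (if Near f (2 ^ (n + 1)) ((1 + Λ) / 2 ^ k / 2 ^ n) z v then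
        ENNReal.ofReal (w * coverRadius ψ N n k ^ s) else 0) ≤
      ENNReal.ofReal (B * w * (4 ^ n / 2 ^ k * coverRadius ψ N n k ^ s)) := by
    intro n k hk
    refine (tsum_indicator_le _ _ (hcard n k hk)).trans_eq ?_
    rw [← ENNReal.ofReal_mul (by positivity)]
    ring_nf
  have hlevel : ∀ (b : Bool) (n : ℕ), ∑' (k : ℕ) (v : ℤ × ℤ × ℤ),
      Metric.ediam (coverSet f ψ N Λ z J (b, n, k, v)) ^ s ≤ ENNReal.ofReal (B * w * cost n) := by
    intro b n
    have hrad : ∀ k, 0 ≤ coverRadius ψ N n k ^ s := fun k =>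
      Real.rpow_nonneg (coverRadius_nonneg hψpos N n k) s
    calc _ ≤ ∑' k : ℕ, if k ≤ N n then
          ENNReal.ofReal (B * w * (4 ^ n / 2 ^ k * coverRadius ψ N n k ^ s)) else 0 := by
          refine ENNReal.tsum_le_tsum fun k => ?_
          refine (ENNReal.tsum_le_tsum fun v =>
            ediam_coverSet_rpow_le hψpos hc hs0 hf N Λ z b n k v).trans ?_
          by_cases hk : k ≤ N n
          · simp only [hk, if_true]
            exact hslab n k hk
          · simp [hk]
      _ = ∑ k ∈ Finset.range (N n + 1),
          ENNReal.ofReal (B * w * (4 ^ n / 2 ^ k * coverRadius ψ N n k ^ s)) := by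
          rw [tsum_eq_sum (s := Finset.range (N n + 1)) (fun k hk => if_neg (by
            rw [Finset.mem_range] at hk; lia))]
          exact Finset.sum_congr rfl fun k hk => if_pos (by
            rw [Finset.mem_range] at hk; lia)
      _ = _ := by
          rw [← ENNReal.ofReal_sum_of_nonneg fun k _ => by have := hrad k; positivity,
            ← Finset.mul_sum]
  rw [ENNReal.tsum_prod', tsum_fintype]
  refine ENNReal.sum_ne_top.2 fun b _ => ne_top_of_le_ne_top
    (hcs.mul_left (B * w)).tsum_ofReal_ne_top ?_
  rw [ENNReal.tsum_prod']
  refine ENNReal.tsum_le_tsum fun n => ?_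
  rw [ENNReal.tsum_prod']
  exact hlevel b n

/-- Every approximation of a point on the graph produces a covering set that contains it. -/
lemma Approx.exists_mem_coverSet {ψ : ℕ → ℝ} (hψdec : Antitone ψ) {f : ℝ → ℝ} {x z Λ : ℝ}
    {J : Set ℝ} (hΛ : 0 ≤ Λ) (hJ : ∀ x ∈ J, |x - z| ≤ 1 / 2)
    (hf : ∀ x x', |x - z| ≤ 1 → |x' - z| ≤ 1 → |f x - f x'| ≤ Λ * |x - x'|) (hx : x ∈ J)
    {v : ℤ × ℤ × ℤ} (hv : Approx ψ x (f x) v) (N : ℕ → ℕ) :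
    ∃ b n k, x ∈ coverSet f ψ N Λ z J (b, n, k, v) := by
  obtain ⟨n, k, h1, h2, hk, ha, hb, hmin⟩ := hv.exists_scale hψdec N
  have hq : (0 : ℝ) < v.1 := by exact_mod_cast hv.pos
  have hq1 : (1 : ℝ) ≤ v.1 := by exact_mod_cast hv.pos
  have ex : |x - v.2.1 / v.1| = |v.1 * x - v.2.1| / v.1 := by
    rw [← abs_of_pos hq, ← abs_div, abs_of_pos hq]; congr 1; field_simp
  have ey : |f x - v.2.2 / v.1| = |v.1 * f x - v.2.2| / v.1 := by
    rw [← abs_of_pos hq, ← abs_div, abs_of_pos hq]; congr 1; field_simp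
  have hX : (0 : ℝ) < 2 ^ n := by positivity
  have hxz := hJ x hx
  have hfst : |x - v.2.1 / v.1| ≤ 1 / 2 := by
    rw [ex]
    exact (div_le_self (abs_nonneg _) hq1).trans hv.fst
  have hwin : |(v.2.1 : ℝ) / v.1 - z| ≤ 1 := by
    have a1 := abs_le.1 hxz
    have a2 := abs_le.1 hfst
    rw [abs_le]
    constructor <;> linarith
  have hnear : Near f (2 ^ (n + 1)) ((1 + Λ) / 2 ^ k / 2 ^ n) z v := by
    refine ⟨hv.prim, hv.pos, by exact_mod_cast h2, hwin, ?_⟩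
    have d1 : |x - v.2.1 / v.1| ≤ 1 / 2 ^ k / 2 ^ n := by
      rw [ex]
      gcongr
    have d2 : |f x - v.2.2 / v.1| ≤ 1 / 2 ^ k / 2 ^ n := by
      rw [ey]
      gcongr
    have d3 := hf x (v.2.1 / v.1) (by linarith) hwin
    calc _ ≤ |(v.2.2 : ℝ) / v.1 - f x| + |f x - f (v.2.1 / v.1)| := abs_sub_le _ _ _
      _ ≤ 1 / 2 ^ k / 2 ^ n + Λ * (1 / 2 ^ k / 2 ^ n) := by
          rw [abs_sub_comm]
          exact add_le_add d2 (d3.trans (mul_le_mul_of_nonneg_left d1 hΛ))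
      _ = _ := by ring
  rcases min_le_iff.1 hmin with hm | hm
  · refine ⟨true, n, k, ?_⟩
    rw [coverSet, if_pos ⟨hk, hnear⟩]
    refine ⟨hx, ?_⟩
    simp only [cond_true]
    rw [ex, coverRadius]
    exact div_le_div₀ ((abs_nonneg _).trans hm) hm hX h1
  · refine ⟨false, n, k, ?_⟩
    rw [coverSet, if_pos ⟨hk, hnear⟩]
    refine ⟨hx, ?_⟩
    simp only [cond_false]
    rw [ey, coverRadius]
    exact div_le_div₀ ((abs_nonneg _).trans hm) hm hX h1

/-- The convergence theorem for the parameter set of a curve with a global dual pair. -/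
lemma DualPair.hausdorffMeasure_eq_zero (h : DualPair K f g φ χ) (hK : 1 ≤ K) {ψ : ℕ → ℝ}
    (hψpos : ∀ q, 0 < ψ q) (hψdec : Antitone ψ) {s c Λ z : ℝ} (hs0 : 0 < s) (hs1 : s ≤ 1)
    (hΛ : 0 ≤ Λ) (hc : 0 < c) {J : Set ℝ} (hJ : ∀ x ∈ J, |x - z| ≤ 1 / 2)
    (hlow : ∀ x ∈ J, ∀ x' ∈ J, c * |x - x'| ≤ |f x - f x'|)
    (hup : ∀ x x', |x - z| ≤ 1 → |x' - z| ≤ 1 → |f x - f x'| ≤ Λ * |x - x'|)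
    (hsum : Summable (fun n : ℕ => ((2 : ℝ) ^ n) ^ (2 - s) * (n : ℝ) ^ s * ψ (2 ^ n) ^ s)) :
    μH[s] {x ∈ J | {q : ℕ | 0 < q ∧ nint (q * x) * nint (q * f x) < ψ q}.Infinite} = 0 := by
  set E := {x ∈ J | {q : ℕ | 0 < q ∧ nint (q * x) * nint (q * f x) < ψ q}.Infinite} with hE
  have hsub : E ⊆ (E ∩ {x | Irrational x}) ∪ Set.range ((↑) : ℚ → ℝ) := by
    intro x hx
    by_cases hi : Irrational x
    · exact Or.inl ⟨hx, hi⟩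
    · exact Or.inr (not_not.1 hi)
  have := Measure.nullSingletonClass_hausdorff ℝ hs0
  refine measure_mono_null hsub (measure_union_null ?_ ((Set.countable_range _).measure_zero _))
  refine hausdorffMeasure_eq_zero_of_tsum_ne_top hs0 _
    (tsum_coverSet_ne_top h hK hψpos hs0 hs1 hΛ hc (z := z) hlow hsum) _ ?_
  rintro x ⟨⟨hxJ, hx⟩, hi⟩
  refine Set.Infinite.of_image (fun i => i.2.2.2) ((infinite_approx hψdec hi hx).mono ?_)
  intro v hv
  obtain ⟨b, n, k, hmem⟩ := Approx.exists_mem_coverSet hψdec hΛ hJ hup hxJ hv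
    (fun n => ⌊(1 - s / 4) * n⌋₊)
  exact ⟨(b, n, k, v), hmem, rfl⟩

lemma le_of_hasDerivAt_of_mul_nonneg {h h' : ℝ → ℝ} (hd : ∀ t, HasDerivAt h (h' t) t) {u : ℝ}
    (hu : ∀ t, 0 ≤ h' t * (t - u)) (x : ℝ) : h u ≤ h x := by
  have hcont : ∀ s : Set ℝ, ContinuousOn h s := fun s t _ => (hd t).continuousAt.continuousWithinAt
  rcases lt_trichotomy u x with hlt | rfl | hlt
  · obtain ⟨c, hc, e⟩ := exists_hasDerivAt_eq_slope h h' hlt (hcont _) fun t _ => hd t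
    have h1 : 0 ≤ h' c := nonneg_of_mul_nonneg_left (hu c) (sub_pos.2 hc.1)
    rw [e, le_div_iff₀ (sub_pos.2 hlt)] at h1
    linarith
  · exact le_rfl
  · obtain ⟨c, hc, e⟩ := exists_hasDerivAt_eq_slope h h' hlt (hcont _) fun t _ => hd t
    have h1 : h' c ≤ 0 := by
      by_contra hcon
      have := mul_neg_of_pos_of_neg (not_le.1 hcon) (sub_neg.2 hc.2)
      linarith [hu c]
    rw [e, div_le_iff₀ (sub_pos.2 hlt)] at h1
    linarith

/-- A function on the line whose derivative is bi-Lipschitz and increasing is part of a dual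
pair. -/
lemma exists_dualPair (hK : 1 ≤ K) (hf : ∀ x, HasDerivAt f (φ x) x)
    (hlow : ∀ x x', x ≤ x' → (x' - x) / K ≤ φ x' - φ x)
    (hup : ∀ x x', x ≤ x' → φ x' - φ x ≤ K * (x' - x)) :
    ∃ g χ, DualPair (2 * K ^ 3) f g φ χ := by
  have hK0 : 0 < K := by linarith
  have hmono : StrictMono φ := fun x x' hxx => by
    have h1 := hlow x x' hxx.le
    have h2 : 0 < (x' - x) / K := div_pos (by linarith) hK0
    linarith
  have hlip : ∀ x x', |φ x - φ x'| ≤ K * |x - x'| := by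
    intro x x'
    rcases le_total x x' with hle | hle
    · rw [abs_sub_comm, abs_of_nonneg (sub_nonneg.2 (hmono.monotone hle)), abs_sub_comm,
        abs_of_nonneg (sub_nonneg.2 hle)]
      exact hup x x' hle
    · rw [abs_of_nonneg (sub_nonneg.2 (hmono.monotone hle)), abs_of_nonneg (sub_nonneg.2 hle)]
      exact hup x' x hle
  have hexp : ∀ x x', |x - x'| ≤ K * |φ x - φ x'| := by
    intro x x'
    rcases le_total x x' with hle | hle
    · rw [abs_sub_comm, abs_of_nonneg (sub_nonneg.2 hle), abs_sub_comm,
        abs_of_nonneg (sub_nonneg.2 (hmono.monotone hle)), mul_comm, ← div_le_iff₀ hK0]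
      exact hlow x x' hle
    · rw [abs_of_nonneg (sub_nonneg.2 (hmono.monotone hle)), abs_of_nonneg (sub_nonneg.2 hle),
        mul_comm, ← div_le_iff₀ hK0]
      exact hlow x' x hle
  have hcont : Continuous φ := by
    have : LipschitzWith K.toNNReal φ := LipschitzWith.of_dist_le_mul fun x x' => by
      rw [Real.dist_eq, Real.dist_eq, Real.coe_toNNReal _ hK0.le]
      exact hlip x x'
    exact this.continuous
  have hsurj : Function.Surjective φ := by
    refine hcont.surjective ?_ ?_
    · refine tendsto_atTop_mono' _ ((eventually_ge_atTop 0).mono fun x hx => ?_)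
        (tendsto_atTop_add_const_left _ (φ 0) (tendsto_id.atTop_div_const hK0))
      have := hlow 0 x hx
      rw [sub_zero] at this
      simp only [id]
      linarith
    · refine tendsto_atBot_mono' _ ((eventually_le_atBot 0).mono fun x hx => ?_)
        (tendsto_atBot_add_const_left _ (φ 0) (tendsto_id.atBot_div_const hK0))
      have := hlow x 0 hx
      rw [zero_sub, neg_div] at this
      simp only [id]
      linarith
  set χ := Function.surjInv hsurj with hχ
  have hright : ∀ y, φ (χ y) = y := Function.surjInv_eq hsurj
  have hleft : ∀ x, χ (φ x) = x := fun x => hmono.injective (hright _)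
  have hmono' : Monotone χ := fun y y' hyy => by
    by_contra hcon
    have := hmono (not_le.1 hcon)
    rw [hright, hright] at this
    linarith
  have hlip' : ∀ y y', |χ y - χ y'| ≤ K * |y - y'| := fun y y' => by
    have := hexp (χ y) (χ y')
    rwa [hright, hright] at this
  set g : ℝ → ℝ := fun y => y * χ y - f (χ y) with hg
  have hder : ∀ (y C : ℝ) (t : ℝ), HasDerivAt (fun t => f t - y * t + C * (t - χ y) ^ 2)
      (φ t - y + C * (2 * (t - χ y))) t := by
    intro y C t
    have h1 := ((hf t).sub ((hasDerivAt_id t).const_mul y)).add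
      ((((hasDerivAt_id t).sub_const (χ y)).pow 2).const_mul C)
    exact h1.congr_deriv (by simp)
  have hD : ∀ x y, (x - χ y) ^ 2 ≤ 2 * K * (f x + g y - x * y) := by
    intro x y
    have := le_of_hasDerivAt_of_mul_nonneg (hder y (-(1 / (2 * K)))) (u := χ y) (fun t => ?_) x
    · simp only [sub_self] at this
      have e : -(1 / (2 * K)) * (x - χ y) ^ 2 = -((x - χ y) ^ 2 / (2 * K)) := by ring
      rw [e] at this
      have h2 : (x - χ y) ^ 2 / (2 * K) ≤ f x + g y - x * y := by
        simp only [hg]; linarith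
      rw [div_le_iff₀ (by positivity)] at h2
      linarith
    · have e : -(1 / (2 * K)) * (2 * (t - χ y)) = -((t - χ y) / K) := by field_simp
      rw [e]
      rcases le_total (χ y) t with hle | hle
      · have := hlow _ _ hle
        rw [hright] at this
        exact mul_nonneg (by linarith) (by linarith)
      · have := hlow _ _ hle
        rw [hright] at this
        have e2 : (χ y - t) / K = -((t - χ y) / K) := by ring
        exact mul_nonneg_of_nonpos_of_nonpos (by linarith) (by linarith)
  have hD' : ∀ x y, 2 * (f x + g y - x * y) ≤ K * (x - χ y) ^ 2 := by
    intro x y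
    have hder' : ∀ t, HasDerivAt (fun t => -(f t - y * t + (-(K / 2)) * (t - χ y) ^ 2))
      (-(φ t - y + (-(K / 2)) * (2 * (t - χ y)))) t := fun t => (hder y (-(K / 2)) t).neg
    have := le_of_hasDerivAt_of_mul_nonneg hder' (u := χ y) (fun t => ?_) x
    · simp only [sub_self] at this
      simp only [hg]
      linarith
    · rcases le_total (χ y) t with hle | hle
      · have := hup _ _ hle
        rw [hright] at this
        exact mul_nonneg (by linarith) (by linarith)
      · have := hup _ _ hle
        rw [hright] at this
        exact mul_nonneg_of_nonpos_of_nonpos (by linarith) (by linarith)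
  have hK2 : K ≤ K ^ 2 := le_self_pow₀ hK (by norm_num)
  have hK3 : K ^ 2 ≤ K ^ 3 := pow_le_pow_right₀ hK (by norm_num)
  have hDnn : ∀ x y, 0 ≤ f x + g y - x * y := fun x y => by
    have := hD x y
    have h2 := sq_nonneg (x - χ y)
    have : 0 ≤ 2 * K * (f x + g y - x * y) := by linarith
    exact nonneg_of_mul_nonneg_right this (by positivity)
  have hsq : ∀ x y, (y - φ x) ^ 2 ≤ K ^ 2 * (x - χ y) ^ 2 := fun x y => by
    rw [← mul_pow]
    refine sq_le_sq.2 ?_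
    rw [abs_mul, abs_of_pos hK0, abs_sub_comm y]
    have := hlip x (χ y)
    rwa [hright] at this
  have hsq' : ∀ x y, (x - χ y) ^ 2 ≤ K ^ 2 * (y - φ x) ^ 2 := fun x y => by
    rw [← mul_pow]
    refine sq_le_sq.2 ?_
    rw [abs_mul, abs_of_pos hK0, abs_sub_comm y]
    have := hexp x (χ y)
    rwa [hright] at this
  refine ⟨g, χ, ?_⟩
  exact
    { one_le := by linarith
      left_inv := hleft
      right_inv := hright
      mono := hmono.monotone
      mono' := hmono'
      lip := fun x x' => (hlip x x').trans
        (mul_le_mul_of_nonneg_right (by linarith) (abs_nonneg _))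
      lip' := fun y y' => (hlip' y y').trans
        (mul_le_mul_of_nonneg_right (by linarith) (abs_nonneg _))
      lower := fun x y => by
        calc _ ≤ K ^ 2 * (2 * K * (f x + g y - x * y)) :=
              (hsq x y).trans (mul_le_mul_of_nonneg_left (hD x y) (by positivity))
          _ = _ := by ring
      upper := fun x y => by
        have h1 := hD' x y
        have h2 := mul_le_mul_of_nonneg_left (hsq' x y) hK0.le
        have h3 := hDnn x y
        have h4 : 0 ≤ K ^ 3 * (y - φ x) ^ 2 := by positivity
        linarith
      lower' := fun x y => (hD x y).trans
        (mul_le_mul_of_nonneg_right (by linarith) (hDnn x y))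
      upper' := fun x y => by
        have h1 := hD' x y
        have h3 := hDnn x y
        have h4 := mul_le_mul_of_nonneg_right (hK2.trans hK3) (sq_nonneg (x - χ y))
        have h5 : 0 ≤ K * (x - χ y) ^ 2 := by positivity
        linarith }

/-- A function with bi-Lipschitz increasing derivative on `[a, b]` extends to the line with the same
property. -/
lemma exists_hasDerivAt_extension {m : ℝ → ℝ} {a b : ℝ} (hab : a ≤ b) (hK : 1 ≤ K)
    (hf : ∀ x ∈ Set.Icc a b, HasDerivAt f (m x) x)
    (hlow : ∀ x ∈ Set.Icc a b, ∀ x' ∈ Set.Icc a b, x ≤ x' → (x' - x) / K ≤ m x' - m x)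
    (hup : ∀ x ∈ Set.Icc a b, ∀ x' ∈ Set.Icc a b, x ≤ x' → m x' - m x ≤ K * (x' - x)) :
    ∃ F φ : ℝ → ℝ, (∀ x ∈ Set.Icc a b, F x = f x) ∧ (∀ x, HasDerivAt F (φ x) x) ∧
      (∀ x x', x ≤ x' → (x' - x) / K ≤ φ x' - φ x) ∧
      ∀ x x', x ≤ x' → φ x' - φ x ≤ K * (x' - x) := by
  have hK0 : 0 < K := by linarith
  set p : ℝ → ℝ := fun x => max a (min b x) with hp
  have hpm : ∀ x, p x ∈ Set.Icc a b := fun x => ⟨le_max_left _ _, max_le hab (min_le_left _ _)⟩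
  have hpid : ∀ x ∈ Set.Icc a b, p x = x := fun x hx => by
    simp only [hp]
    rw [min_eq_right hx.2, max_eq_right hx.1]
  have hpmono : Monotone p := fun x x' hxx => max_le_max le_rfl (min_le_min le_rfl hxx)
  have hplip : ∀ x x', x ≤ x' → p x' - p x ≤ x' - x := by
    intro x x' hxx
    simp only [hp]
    rcases max_cases a (min b x') with h | h <;> rcases max_cases a (min b x) with h' | h' <;>
      rcases min_cases b x' with h3 | h3 <;> rcases min_cases b x with h4 | h4 <;> linarith
  set φ : ℝ → ℝ := fun x => m (p x) + (x - p x) with hφ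
  have hφlow : ∀ x x', x ≤ x' → (x' - x) / K ≤ φ x' - φ x := by
    intro x x' hxx
    have h1 := hlow _ (hpm x) _ (hpm x') (hpmono hxx)
    have h2 := hplip x x' hxx
    have h3 : ((x' - x) - (p x' - p x)) / K ≤ (x' - x) - (p x' - p x) :=
      div_le_self (by linarith) hK
    rw [sub_div] at h3
    simp only [hφ]
    linarith
  have hφup : ∀ x x', x ≤ x' → φ x' - φ x ≤ K * (x' - x) := by
    intro x x' hxx
    have h1 := hup _ (hpm x) _ (hpm x') (hpmono hxx)
    have h2 := hplip x x' hxx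
    have h3 : (x' - x) - (p x' - p x) ≤ K * ((x' - x) - (p x' - p x)) :=
      le_mul_of_one_le_left (by linarith) hK
    simp only [hφ]
    linarith
  have hφmono : Monotone φ := fun x x' hxx => by
    have h1 := hφlow x x' hxx
    have h2 : 0 ≤ (x' - x) / K := div_nonneg (by linarith) hK0.le
    linarith
  have hφcont : Continuous φ := by
    have : LipschitzWith K.toNNReal φ := LipschitzWith.of_dist_le_mul fun x x' => by
      rw [Real.dist_eq, Real.dist_eq, Real.coe_toNNReal _ hK0.le]
      rcases le_total x x' with hle | hle
      · rw [abs_sub_comm, abs_of_nonneg (sub_nonneg.2 (hφmono hle)), abs_sub_comm,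
          abs_of_nonneg (sub_nonneg.2 hle)]
        exact hφup x x' hle
      · rw [abs_of_nonneg (sub_nonneg.2 (hφmono hle)), abs_of_nonneg (sub_nonneg.2 hle)]
        exact hφup x' x hle
    exact this.continuous
  refine ⟨fun x => f a + ∫ t in a..x, φ t, φ, fun x hx => ?_, fun x => ?_, hφlow, hφup⟩
  · have := intervalIntegral.integral_eq_sub_of_hasDerivAt (a := a) (b := x) (f := f) (f' := φ)
      (fun t ht => ?_) (hφcont.intervalIntegrable _ _)
    · simp only [this]
      ring
    · rw [Set.uIcc_of_le hx.1] at ht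
      have ht' : t ∈ Set.Icc a b := ⟨ht.1, ht.2.trans hx.2⟩
      have := hf t ht'
      rwa [show φ t = m t by simp only [hφ]; rw [hpid t ht']; ring]
  · exact (hφcont.integral_hasStrictDerivAt a x).hasDerivAt.const_add _

/-- The convergence theorem for the parameter set of a short convex arc. -/
lemma hausdorffMeasure_eq_zero_of_convex_arc {m m₂ : ℝ → ℝ} {a b κ L c : ℝ} (hab : a ≤ b)
    (hba : b - a ≤ 1 / 2) (hκ : 0 < κ) (hc : 0 < c)
    (hf : ∀ x ∈ Set.Icc a b, HasDerivAt f (m x) x)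
    (hm : ∀ x ∈ Set.Icc a b, HasDerivAt m (m₂ x) x)
    (hm₂ : ∀ x ∈ Set.Icc a b, κ ≤ m₂ x ∧ m₂ x ≤ L)
    (hcm : ∀ x ∈ Set.Icc a b, c ≤ |m x|) {ψ : ℕ → ℝ}
    (hψpos : ∀ q, 0 < ψ q) (hψdec : Antitone ψ) {s : ℝ} (hs0 : 0 < s) (hs1 : s ≤ 1)
    (hsum : Summable (fun n : ℕ => ((2 : ℝ) ^ n) ^ (2 - s) * (n : ℝ) ^ s * ψ (2 ^ n) ^ s)) :
    μH[s] {x ∈ Set.Icc a b |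
      {q : ℕ | 0 < q ∧ nint (q * x) * nint (q * f x) < ψ q}.Infinite} = 0 := by
  set K : ℝ := max 1 (max L (1 / κ)) with hKdef
  have hK : 1 ≤ K := le_max_left _ _
  have hK0 : 0 < K := by linarith
  have hKL : L ≤ K := (le_max_left _ _).trans (le_max_right _ _)
  have hKκ : 1 / K ≤ κ := by
    rw [div_le_comm₀ hK0 hκ]
    exact (le_max_right _ _).trans (le_max_right _ _)
  have slope : ∀ {h h' : ℝ → ℝ}, (∀ x ∈ Set.Icc a b, HasDerivAt h (h' x) x) →
      ∀ x ∈ Set.Icc a b, ∀ x' ∈ Set.Icc a b, x < x' →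
        ∃ ξ ∈ Set.Icc a b, h x' - h x = h' ξ * (x' - x) := by
    intro h h' hh x hx x' hx' hlt
    have hsub : Set.Icc x x' ⊆ Set.Icc a b := Set.Icc_subset_Icc hx.1 hx'.2
    obtain ⟨ξ, hξ, e⟩ := exists_hasDerivAt_eq_slope h h' hlt
      (fun t ht => (hh t (hsub ht)).continuousAt.continuousWithinAt)
      (fun t ht => hh t (hsub (Set.Ioo_subset_Icc_self ht)))
    refine ⟨ξ, hsub (Set.Ioo_subset_Icc_self hξ), ?_⟩
    have : x' - x ≠ 0 := (sub_pos.2 hlt).ne'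
    rw [e]
    field_simp
  obtain ⟨F, φ, hFf, hF, hφlow, hφup⟩ := exists_hasDerivAt_extension hab hK hf
    (fun x hx x' hx' hle => by
      rcases hle.eq_or_lt with rfl | hlt
      · simp
      obtain ⟨ξ, hξ, e⟩ := slope hm x hx x' hx' hlt
      rw [e, div_eq_mul_one_div, mul_comm]
      exact mul_le_mul_of_nonneg_right (hKκ.trans (hm₂ ξ hξ).1) (by linarith))
    (fun x hx x' hx' hle => by
      rcases hle.eq_or_lt with rfl | hlt
      · simp
      obtain ⟨ξ, hξ, e⟩ := slope hm x hx x' hx' hlt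
      rw [e]
      exact mul_le_mul_of_nonneg_right ((hm₂ ξ hξ).2.trans hKL) (by linarith))
  obtain ⟨g, χ, hdual⟩ := exists_dualPair hK hF hφlow hφup
  have hset : {x ∈ Set.Icc a b |
      {q : ℕ | 0 < q ∧ nint (q * x) * nint (q * f x) < ψ q}.Infinite} = {x ∈ Set.Icc a b |
      {q : ℕ | 0 < q ∧ nint (q * x) * nint (q * F x) < ψ q}.Infinite} := by
    ext x
    exact and_congr_right fun hx => by rw [hFf x hx]
  rw [hset]
  refine hdual.hausdorffMeasure_eq_zero hdual.one_le hψpos hψdec (c := c)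
    (Λ := |φ (a - 1)| + |φ (a + 1)|) (z := a) hs0 hs1 (by positivity) hc ?_ ?_ ?_ hsum
  · intro x hx
    rw [abs_of_nonneg (by linarith [hx.1])]
    linarith [hx.2]
  · have key : ∀ x ∈ Set.Icc a b, ∀ x' ∈ Set.Icc a b, x < x' → c * |x - x'| ≤ |F x - F x'| := by
      intro x hx x' hx' hlt
      obtain ⟨ξ, hξ, e⟩ := slope hf x hx x' hx' hlt
      rw [hFf x hx, hFf x' hx', abs_sub_comm (f x), e, abs_mul, abs_sub_comm x]
      exact mul_le_mul_of_nonneg_right (hcm ξ hξ) (abs_nonneg _)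
    intro x hx x' hx'
    rcases lt_trichotomy x x' with hlt | rfl | hlt
    · exact key x hx x' hx' hlt
    · simp
    · rw [abs_sub_comm x, abs_sub_comm (F x)]
      exact key x' hx' x hx hlt
  · have hmono : Monotone φ := fun x x' hle => by
      have h1 := hφlow x x' hle
      have h2 : 0 ≤ (x' - x) / K := div_nonneg (by linarith) hK0.le
      linarith
    intro x x' hx hx'
    refine (convex_Icc (a - 1) (a + 1)).norm_image_sub_le_of_norm_hasDerivWithin_le (f := F)
      (f' := φ) (x := x') (y := x) (fun t _ => (hF t).hasDerivWithinAt) (fun t ht => ?_) ?_ ?_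
    · rw [Real.norm_eq_abs, abs_le]
      have h1 := hmono ht.1
      have h2 := hmono ht.2
      have h3 := neg_abs_le (φ (a - 1))
      have h4 := le_abs_self (φ (a + 1))
      have h5 := abs_nonneg (φ (a - 1))
      have h6 := abs_nonneg (φ (a + 1))
      constructor <;> linarith
    · have := abs_le.1 hx'
      exact ⟨by linarith, by linarith⟩
    · have := abs_le.1 hx
      exact ⟨by linarith, by linarith⟩

/-- The Lipschitz parametrisation of a graph transports null sets. -/
lemma hausdorffMeasure_graph_eq_zero {J X : Set ℝ} {C s : ℝ} (hC : 0 ≤ C) (hs : 0 ≤ s)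
    (hf : ∀ x ∈ J, ∀ x' ∈ J, |f x - f x'| ≤ C * |x - x'|) (hXJ : X ⊆ J) (hX : μH[s] X = 0)
    {E : Set (EuclideanSpace ℝ (Fin 2))} (hE : ∀ p ∈ E, p 0 ∈ X ∧ p 1 = f (p 0)) :
    μH[s] E = 0 := by
  have hlip : LipschitzOnWith (1 + C).toNNReal
      (fun x => (!₂[x, f x] : EuclideanSpace ℝ (Fin 2))) X := by
    refine LipschitzOnWith.of_dist_le_mul fun x hx x' hx' => ?_
    rw [Real.coe_toNNReal _ (by linarith), EuclideanSpace.dist_eq, Fin.sum_univ_two]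
    refine Real.sqrt_le_iff.2 ⟨by positivity, ?_⟩
    have h1 := hf x (hXJ hx) x' (hXJ hx')
    simp only [Real.dist_eq, Matrix.cons_val_zero, Matrix.cons_val_one]
    have h2 : |f x - f x'| ^ 2 ≤ (C * |x - x'|) ^ 2 := by gcongr
    have h3 : 0 ≤ C * |x - x'| ^ 2 := by positivity
    nlinarith
  have hsub : E ⊆ (fun x => (!₂[x, f x] : EuclideanSpace ℝ (Fin 2))) '' X := by
    intro p hp
    obtain ⟨h1, h2⟩ := hE p hp
    refine ⟨p 0, h1, ?_⟩
    ext i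
    fin_cases i
    · simp
    · simp [h2]
  refine measure_mono_null hsub (le_antisymm ((hlip.hausdorffMeasure_image_le hs).trans ?_) bot_le)
  simp [hX]

end

/-- **Theorem 2** (multiplicative convergence result on planar curves): if
`0 < s ≤ 1` and `Σ_h h^{1-s} (log h)^s ψ(h)^s < ∞`, then
`ℋ^s(C_f ∩ S₂*(ψ)) = 0` for any non-degenerate planar curve `C_f`. -/
theorem hausdorff_measure_curve_inter_S2star_eq_zero
    (I : Set ℝ) (hIopen : IsOpen I) (hIconn : I.OrdConnected)
    (f : ℝ → ℝ) (hf : ContDiffOn ℝ 3 f I)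
    (c₁ c₂ : ℝ) (hc₂pos : 0 < c₂) (hc₂₁ : c₂ < c₁)
    (hderiv : ∀ x ∈ I, c₂ < deriv f x ∧ deriv f x < c₁)
    (hderiv2 : ∀ x ∈ I, iteratedDeriv 2 f x ≠ 0)
    (ψ : ℕ → ℝ) (hψpos : ∀ q, 0 < ψ q) (hψdec : Antitone ψ)
    (s : ℝ) (hs0 : 0 < s) (hs1 : s ≤ 1)
    (hsum : Summable (fun h : ℕ => (h : ℝ) ^ (1 - s) * Real.log h ^ s * ψ h ^ s)) :
    μH[s] ({ p : EuclideanSpace ℝ (Fin 2) | p 0 ∈ I ∧ p 1 = f (p 0) } ∩ S2star ψ) = 0 := by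
  have hsum' := summable_condensed hψpos hψdec hs0 hs1 hsum
  have hf1 : ContDiffOn ℝ 2 (deriv f) I := hf.deriv_of_isOpen hIopen (by norm_num)
  have hf2 : ContDiffOn ℝ 1 (deriv (deriv f)) I := hf1.deriv_of_isOpen hIopen (by norm_num)
  have hd : ∀ x ∈ I, HasDerivAt f (deriv f x) x := fun x hx =>
    ((hf.differentiableOn (by norm_num)).differentiableAt (hIopen.mem_nhds hx)).hasDerivAt
  have hd1 : ∀ x ∈ I, HasDerivAt (deriv f) (deriv (deriv f) x) x := fun x hx =>
    ((hf1.differentiableOn (by norm_num)).differentiableAt (hIopen.mem_nhds hx)).hasDerivAt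
  have hne : ∀ x ∈ I, deriv (deriv f) x ≠ 0 := fun x hx => by
    have := hderiv2 x hx
    rwa [iteratedDeriv_succ, iteratedDeriv_one] at this
  refine measure_null_of_locally_null _ fun p hp => ?_
  obtain ⟨⟨hpI, -⟩, -⟩ := hp
  set d := deriv (deriv f) (p 0) with hdef
  have hd0 : 0 < |d| := abs_pos.2 (hne _ hpI)
  have hcont : ContinuousAt (deriv (deriv f)) (p 0) :=
    hf2.continuousOn.continuousAt (hIopen.mem_nhds hpI)
  obtain ⟨r, hr, hball⟩ := Metric.mem_nhds_iff.1 (inter_mem (hIopen.mem_nhds hpI)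
    (hcont (Metric.ball_mem_nhds _ (half_pos hd0))))
  set δ := min (r / 2) (1 / 4) with hδ
  have hδ0 : 0 < δ := lt_min (by linarith) (by norm_num)
  have hδr : δ < r := (min_le_left _ _).trans_lt (by linarith)
  have hδ4 : δ ≤ 1 / 4 := min_le_right _ _
  set J := Set.Icc (p 0 - δ) (p 0 + δ) with hJ
  have hJball : ∀ x ∈ J, x ∈ I ∧ |deriv (deriv f) x - d| < |d| / 2 := fun x hx => by
    have hx' : x ∈ Metric.ball (p 0) r := by
      rw [Metric.mem_ball, Real.dist_eq, abs_lt]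
      constructor <;> linarith [hx.1, hx.2]
    exact ⟨(hball hx').1, (hball hx').2⟩
  set X := {x ∈ J | {q : ℕ | 0 < q ∧ nint (q * x) * nint (q * f x) < ψ q}.Infinite} with hX
  have hX0 : μH[s] X = 0 := by
    rcases lt_or_gt_of_ne (hne _ hpI) with hneg | hpos
    · have : X = {x ∈ J |
          {q : ℕ | 0 < q ∧ nint (q * x) * nint (q * (-f) x) < ψ q}.Infinite} := by
        simp only [hX, Pi.neg_apply, mul_neg, nint_neg]
      rw [this]
      refine hausdorffMeasure_eq_zero_of_convex_arc (f := -f) (m := -deriv f)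
        (m₂ := -deriv (deriv f)) (κ := |d| / 2) (L := 2 * |d|) (c := c₂) (by linarith)
        (by linarith) (by linarith) hc₂pos (fun x hx => (hd x (hJball x hx).1).neg)
        (fun x hx => (hd1 x (hJball x hx).1).neg) (fun x hx => ?_) (fun x hx => ?_)
        hψpos hψdec hs0 hs1 hsum'
      · have h1 := abs_lt.1 (hJball x hx).2
        have h2 := abs_of_neg hneg
        rw [← hdef] at h2
        simp only [Pi.neg_apply]
        constructor <;> linarith
      · rw [Pi.neg_apply, abs_neg]
        exact (hderiv x (hJball x hx).1).1.le.trans (le_abs_self _)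
    · refine hausdorffMeasure_eq_zero_of_convex_arc (m := deriv f)
        (m₂ := deriv (deriv f)) (κ := |d| / 2) (L := 2 * |d|) (c := c₂) (by linarith)
        (by linarith) (by linarith) hc₂pos (fun x hx => hd x (hJball x hx).1)
        (fun x hx => hd1 x (hJball x hx).1) (fun x hx => ?_) (fun x hx => ?_)
        hψpos hψdec hs0 hs1 hsum'
      · have h1 := abs_lt.1 (hJball x hx).2
        have h2 := abs_of_pos hpos
        rw [← hdef] at h2
        constructor <;> linarith
      · exact (hderiv x (hJball x hx).1).1.le.trans (le_abs_self _)
  have hU : {q : EuclideanSpace ℝ (Fin 2) | q 0 ∈ J} ∈ nhds p := by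
    have hc : Continuous fun q : EuclideanSpace ℝ (Fin 2) => q 0 := by fun_prop
    exact hc.continuousAt.preimage_mem_nhds (Icc_mem_nhds (by linarith) (by linarith))
  refine ⟨_, inter_mem self_mem_nhdsWithin (mem_nhdsWithin_of_mem_nhds hU), ?_⟩
  refine hausdorffMeasure_graph_eq_zero (f := f) (J := J) (C := c₁) (by linarith) hs0.le ?_
    (Set.sep_subset _ _) hX0 ?_
  · intro x hx x' hx'
    refine (convex_Icc (p 0 - δ) (p 0 + δ)).norm_image_sub_le_of_norm_hasDerivWithin_le (f := f)
      (f' := deriv f) (x := x') (y := x)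
      (fun t ht => (hd t (hJball t ht).1).hasDerivWithinAt) (fun t ht => ?_) hx' hx
    have := hderiv t (hJball t ht).1
    rw [Real.norm_eq_abs, abs_le]
    constructor <;> linarith
  · rintro q ⟨⟨⟨-, hq1⟩, hq2⟩, hq3⟩
    refine ⟨⟨hq3, ?_⟩, hq1⟩
    rw [← hq1]
    exact hq2
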